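/- arXiv:2503.23296 — 2 statements merged into one kernel-verified Lean document; each statement's English description precedes it below -/
import Mathlib

section
/- Discrete surjectivity of the divergence with uniform bound: there exists a constant C depending only on Ω=(0,L_x)×(0,L_y) and on the mesh-regularity constant C₀ (where min_{i,j}{h_{i+1/2},k_{j+1/2}} ≥ C₀·max_{i,j}{h_{i+1/2},k_{j+1/2}}), but not on h, k, N_x, N_y, such that: for every cell-centered grid function q with (q,1)_{l2,M}=0 there exists a discrete velocity v=(v^x,v^y) (v^x at points (x_i,y_{j+1/2}) vanishing at i=0,N_x; v^y at points (x_{i+1/2},y_j) vanishing at j=0,N_y) satisfying (d_x v^x + d_y v^y)_{i+1/2,j+1/2} = q_{i+1/2,j+1/2} for all 0≤i≤N_x−1, 0≤j≤N_y−1, and ‖v‖_{l2} + ‖Dv‖_{l2} ≤ C‖q‖_{l2,M}. -/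
open Finset MeasureTheory Real

noncomputable section

namespace RMAC

/-! ### Continuous-level notions -/

/-- Partial derivative in the first (x) variable of a function of (x, y, t). -/
def pdx (f : ℝ → ℝ → ℝ → ℝ) : ℝ → ℝ → ℝ → ℝ := fun x y t => deriv (fun s => f s y t) x

/-- Partial derivative in the second (y) variable. -/
def pdy (f : ℝ → ℝ → ℝ → ℝ) : ℝ → ℝ → ℝ → ℝ := fun x y t => deriv (fun s => f x s t) y

/-- Partial derivative in the third (t) variable. -/
def pdt (f : ℝ → ℝ → ℝ → ℝ) : ℝ → ℝ → ℝ → ℝ := fun x y t => deriv (fun s => f x y s) t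

/-- Infinitely differentiable function of (x, y, t). -/
def Smooth (f : ℝ → ℝ → ℝ → ℝ) : Prop :=
  ∀ n : ℕ, ContDiff ℝ n (fun q : ℝ × ℝ × ℝ => f q.1 q.2.1 q.2.2)

/-- `SobBound a b f Lx Ly T M` : all derivatives `∂_t^{a'} ∂_x^{b'} ∂_y^{c'} f` with `a' ≤ a`,
`b' + c' ≤ b` are bounded by `M` on `[0,Lx] × [0,Ly] × [0,T]`; this encodes
`‖f‖_{W^{a,∞}([0,T];W^{b,∞}(Ω))} ≤ M`. -/
def SobBound (a b : ℕ) (f : ℝ → ℝ → ℝ → ℝ) (Lx Ly T M : ℝ) : Prop :=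
  ∀ a' b' c' : ℕ, a' ≤ a → b' + c' ≤ b →
    ∀ x y t : ℝ, x ∈ Set.Icc 0 Lx → y ∈ Set.Icc 0 Ly → t ∈ Set.Icc 0 T →
      |(pdt^[a'] (pdx^[b'] (pdy^[c'] f))) x y t| ≤ M

/-- The time-dependent Stokes problem on `Ω = (0,Lx) × (0,Ly)`, `t ∈ (0,T]`, with
viscosity `μ`, source `(gx, gy)`, homogeneous Dirichlet boundary condition and
homogeneous initial condition. -/
def IsStokesSol (μ Lx Ly T : ℝ) (ux uy p gx gy : ℝ → ℝ → ℝ → ℝ) : Prop :=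
  (∀ x y t : ℝ, x ∈ Set.Ioo 0 Lx → y ∈ Set.Ioo 0 Ly → t ∈ Set.Ioc 0 T →
      pdt ux x y t - μ * (pdx (pdx ux) x y t + pdy (pdy ux) x y t) + pdx p x y t = gx x y t ∧
      pdt uy x y t - μ * (pdx (pdx uy) x y t + pdy (pdy uy) x y t) + pdy p x y t = gy x y t ∧
      pdx ux x y t + pdy uy x y t = 0) ∧
  (∀ x y t : ℝ, x ∈ Set.Icc 0 Lx → y ∈ Set.Icc 0 Ly → t ∈ Set.Ioc 0 T →
      (x = 0 ∨ x = Lx ∨ y = 0 ∨ y = Ly) → ux x y t = 0 ∧ uy x y t = 0) ∧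
  (∀ x y : ℝ, x ∈ Set.Icc 0 Lx → y ∈ Set.Icc 0 Ly → ux x y 0 = 0 ∧ uy x y 0 = 0)

/-- Divergence-free velocity field on `Ω` for all times in `[0,T]`. -/
def DivFree (Lx Ly T : ℝ) (ux uy : ℝ → ℝ → ℝ → ℝ) : Prop :=
  ∀ x y t : ℝ, x ∈ Set.Ioo 0 Lx → y ∈ Set.Ioo 0 Ly → t ∈ Set.Icc 0 T →
    pdx ux x y t + pdy uy x y t = 0

/-- Homogeneous velocity boundary values on `∂Ω` for all times in `[0,T]`. -/
def BoundaryZero (Lx Ly T : ℝ) (ux uy : ℝ → ℝ → ℝ → ℝ) : Prop :=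
  ∀ x y t : ℝ, x ∈ Set.Icc 0 Lx → y ∈ Set.Icc 0 Ly → t ∈ Set.Icc 0 T →
    (x = 0 ∨ x = Lx ∨ y = 0 ∨ y = Ly) → ux x y t = 0 ∧ uy x y t = 0

/-! ### The staggered (MAC) grid

Index conventions for grid functions `f : ℤ → ℤ → ℝ`:
* cell-centered functions: `f i j` is the value at `(x_{i+1/2}, y_{j+1/2})`;
* x-edge functions (like `u^x`): `f i j` is the value at `(x_i, y_{j+1/2})`,
  with `j = -1` and `j = Ny` the ghost values representing `(x_i, y_0)` and `(x_i, y_{Ny})`;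
* y-edge functions (like `u^y`): `f i j` is the value at `(x_{i+1/2}, y_j)`,
  with `i = -1` and `i = Nx` the ghost values representing `(x_0, y_j)` and `(x_{Nx}, y_j)`;
* node functions: `f i j` is the value at `(x_i, y_j)`. -/
structure Grid where
  Nx : ℕ
  Ny : ℕ
  Lx : ℝ
  Ly : ℝ
  xp : ℤ → ℝ
  yp : ℤ → ℝ
  one_le_Nx : 1 ≤ Nx
  one_le_Ny : 1 ≤ Ny
  xp_zero : xp 0 = 0
  xp_last : xp Nx = Lx
  yp_zero : yp 0 = 0
  yp_last : yp Ny = Ly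
  xp_mono : ∀ i : ℤ, 0 ≤ i → i < Nx → xp i < xp (i + 1)
  yp_mono : ∀ j : ℤ, 0 ≤ j → j < Ny → yp j < yp (j + 1)

namespace Grid

variable (G : Grid)

/-- `h_{i+1/2} = x_{i+1} - x_i`. -/
def hh (i : ℤ) : ℝ := G.xp (i + 1) - G.xp i

/-- `k_{j+1/2} = y_{j+1} - y_j`. -/
def kk (j : ℤ) : ℝ := G.yp (j + 1) - G.yp j

/-- `x_{i+1/2} = (x_i + x_{i+1})/2`. -/
def xh (i : ℤ) : ℝ := (G.xp i + G.xp (i + 1)) / 2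

/-- `y_{j+1/2} = (y_j + y_{j+1})/2`. -/
def yh (j : ℤ) : ℝ := (G.yp j + G.yp (j + 1)) / 2

/-- `h_i = (h_{i-1/2} + h_{i+1/2})/2`, with `h_0 = h_{1/2}/2`, `h_{Nx} = h_{Nx-1/2}/2`. -/
def hc (i : ℤ) : ℝ :=
  if i = 0 then G.hh 0 / 2
  else if i = (G.Nx : ℤ) then G.hh ((G.Nx : ℤ) - 1) / 2
  else (G.hh (i - 1) + G.hh i) / 2

/-- `k_j = (k_{j-1/2} + k_{j+1/2})/2`, with `k_0 = k_{1/2}/2`, `k_{Ny} = k_{Ny-1/2}/2`. -/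
def kc (j : ℤ) : ℝ :=
  if j = 0 then G.kk 0 / 2
  else if j = (G.Ny : ℤ) then G.kk ((G.Ny : ℤ) - 1) / 2
  else (G.kk (j - 1) + G.kk j) / 2

/-- `h = max_i h_{i+1/2}`. -/
def hmax : ℝ :=
  (Finset.Icc (0 : ℤ) ((G.Nx : ℤ) - 1)).sup'
    (Finset.nonempty_Icc.mpr (by have := G.one_le_Nx; omega)) G.hh

/-- `k = max_j k_{j+1/2}`. -/
def kmax : ℝ :=
  (Finset.Icc (0 : ℤ) ((G.Ny : ℤ) - 1)).sup'
    (Finset.nonempty_Icc.mpr (by have := G.one_le_Ny; omega)) G.kk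

/-- Mesh regularity: `min_{i,j} {h_{i+1/2}, k_{j+1/2}} ≥ C₀ · max_{i,j} {h_{i+1/2}, k_{j+1/2}}`. -/
def Regular (C₀ : ℝ) : Prop :=
  (∀ i : ℤ, 0 ≤ i → i < G.Nx → C₀ * G.hmax ≤ G.hh i ∧ C₀ * G.kmax ≤ G.hh i) ∧
  (∀ j : ℤ, 0 ≤ j → j < G.Ny → C₀ * G.hmax ≤ G.kk j ∧ C₀ * G.kmax ≤ G.kk j)

/-! ### Difference operators -/

/-- `d_x` of an x-edge function: value at the cell center `(x_{i+1/2}, y_{j+1/2})`. -/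
def dxEx (f : ℤ → ℤ → ℝ) (i j : ℤ) : ℝ := (f (i + 1) j - f i j) / G.hh i

/-- `D_y` of an x-edge function: value at the node `(x_i, y_j)`. -/
def DyEx (f : ℤ → ℤ → ℝ) (i j : ℤ) : ℝ := (f i j - f i (j - 1)) / G.kc j

/-- `d_y` of a y-edge function: value at the cell center `(x_{i+1/2}, y_{j+1/2})`. -/
def dyEy (f : ℤ → ℤ → ℝ) (i j : ℤ) : ℝ := (f i (j + 1) - f i j) / G.kk j

/-- `D_x` of a y-edge function: value at the node `(x_i, y_j)`. -/
def DxEy (f : ℤ → ℤ → ℝ) (i j : ℤ) : ℝ := (f i j - f (i - 1) j) / G.hc i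

/-- `D_x` of a cell-centered function: value at the x-edge point `(x_i, y_{j+1/2})`. -/
def DxC (q : ℤ → ℤ → ℝ) (i j : ℤ) : ℝ := (q i j - q (i - 1) j) / G.hc i

/-- `D_y` of a cell-centered function: value at the y-edge point `(x_{i+1/2}, y_j)`. -/
def DyC (q : ℤ → ℤ → ℝ) (i j : ℤ) : ℝ := (q i j - q i (j - 1)) / G.kc j

/-! ### Discrete inner products and norms -/

/-- `(f,g)_{l²,M}` over cell centers. -/
def ipM (f g : ℤ → ℤ → ℝ) : ℝ :=
  ∑ i ∈ Finset.Icc (0 : ℤ) ((G.Nx : ℤ) - 1), ∑ j ∈ Finset.Icc (0 : ℤ) ((G.Ny : ℤ) - 1),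
    G.hh i * G.kk j * f i j * g i j

/-- `(f,g)_{l²,T,M}` over x-edge points. -/
def ipTM (f g : ℤ → ℤ → ℝ) : ℝ :=
  ∑ i ∈ Finset.Icc (1 : ℤ) ((G.Nx : ℤ) - 1), ∑ j ∈ Finset.Icc (0 : ℤ) ((G.Ny : ℤ) - 1),
    G.hc i * G.kk j * f i j * g i j

/-- `(f,g)_{l²,M,T}` over y-edge points. -/
def ipMT (f g : ℤ → ℤ → ℝ) : ℝ :=
  ∑ i ∈ Finset.Icc (0 : ℤ) ((G.Nx : ℤ) - 1), ∑ j ∈ Finset.Icc (1 : ℤ) ((G.Ny : ℤ) - 1),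
    G.hh i * G.kc j * f i j * g i j

/-- `(f,g)_{l²,T_x}`. -/
def ipTx (f g : ℤ → ℤ → ℝ) : ℝ :=
  ∑ i ∈ Finset.Icc (0 : ℤ) (G.Nx : ℤ), ∑ j ∈ Finset.Icc (1 : ℤ) ((G.Ny : ℤ) - 1),
    G.hc i * G.kc j * f i j * g i j

/-- `(f,g)_{l²,T_y}`. -/
def ipTy (f g : ℤ → ℤ → ℝ) : ℝ :=
  ∑ i ∈ Finset.Icc (1 : ℤ) ((G.Nx : ℤ) - 1), ∑ j ∈ Finset.Icc (0 : ℤ) (G.Ny : ℤ),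
    G.hc i * G.kc j * f i j * g i j

/-- `‖v‖²_{l²} = ‖v^x‖²_{l²,T,M} + ‖v^y‖²_{l²,M,T}` for a discrete velocity. -/
def velNormSq (vx vy : ℤ → ℤ → ℝ) : ℝ := G.ipTM vx vx + G.ipMT vy vy

/-- `‖Dv‖²_{l²}` for a discrete velocity. -/
def DvelNormSq (vx vy : ℤ → ℤ → ℝ) : ℝ :=
  G.ipM (G.dxEx vx) (G.dxEx vx) + G.ipTy (G.DyEx vx) (G.DyEx vx) +
    G.ipTx (G.DxEy vy) (G.DxEy vy) + G.ipM (G.dyEy vy) (G.dyEy vy)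

/-! ### Right-hand side discretization and the RMAC scheme -/

/-- `f^{x,n}_{i,j+1/2} = (1/h_i) ∫_{x_{i-1/2}}^{x_{i+1/2}} g^x(x, y_{j+1/2}, t^n) dx`. -/
def avgFx (gx : ℝ → ℝ → ℝ → ℝ) (Δt : ℝ) : ℕ → ℤ → ℤ → ℝ := fun n i j =>
  (1 / G.hc i) * ∫ x in (G.xh (i - 1))..(G.xh i), gx x (G.yh j) ((n : ℝ) * Δt)

/-- `f^{y,n}_{i+1/2,j} = (1/k_j) ∫_{y_{j-1/2}}^{y_{j+1/2}} g^y(x_{i+1/2}, y, t^n) dy`. -/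
def avgFy (gy : ℝ → ℝ → ℝ → ℝ) (Δt : ℝ) : ℕ → ℤ → ℤ → ℝ := fun n i j =>
  (1 / G.kc j) * ∫ y in (G.yh (j - 1))..(G.yh j), gy (G.xh i) y ((n : ℝ) * Δt)

/-- The RMAC scheme for the time-dependent Stokes equations, with discrete right-hand
sides `fx`, `fy`: homogeneous discrete boundary and initial conditions, the two discrete
momentum equations and the discrete divergence-free constraint. -/
def IsRMAC (μ Δt : ℝ) (fx fy Wx Wy Z : ℕ → ℤ → ℤ → ℝ) : Prop :=
  (∀ n : ℕ, ∀ j : ℤ, Wx n 0 j = 0 ∧ Wx n (G.Nx : ℤ) j = 0) ∧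
  (∀ n : ℕ, ∀ i : ℤ, Wx n i (-1) = 0 ∧ Wx n i (G.Ny : ℤ) = 0) ∧
  (∀ n : ℕ, ∀ i : ℤ, Wy n i 0 = 0 ∧ Wy n i (G.Ny : ℤ) = 0) ∧
  (∀ n : ℕ, ∀ j : ℤ, Wy n (-1) j = 0 ∧ Wy n (G.Nx : ℤ) j = 0) ∧
  (∀ i j : ℤ, Wx 0 i j = 0 ∧ Wy 0 i j = 0) ∧
  (∀ n : ℕ, 1 ≤ n →
    ∀ i ∈ Finset.Icc (1 : ℤ) ((G.Nx : ℤ) - 1), ∀ j ∈ Finset.Icc (0 : ℤ) ((G.Ny : ℤ) - 1),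
      (Wx n i j - Wx (n - 1) i j) / Δt
        - μ * ((G.dxEx (Wx n) i j - G.dxEx (Wx n) (i - 1) j) / G.hc i)
        - μ * ((G.DyEx (Wx n) i (j + 1) - G.DyEx (Wx n) i j) / G.kk j)
        + G.DxC (Z n) i j = fx n i j) ∧
  (∀ n : ℕ, 1 ≤ n →
    ∀ i ∈ Finset.Icc (0 : ℤ) ((G.Nx : ℤ) - 1), ∀ j ∈ Finset.Icc (1 : ℤ) ((G.Ny : ℤ) - 1),
      (Wy n i j - Wy (n - 1) i j) / Δt
        - μ * ((G.DxEy (Wy n) (i + 1) j - G.DxEy (Wy n) i j) / G.hh i)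
        - μ * ((G.dyEy (Wy n) i j - G.dyEy (Wy n) i (j - 1)) / G.kc j)
        + G.DyC (Z n) i j = fy n i j) ∧
  (∀ n : ℕ, 1 ≤ n →
    ∀ i ∈ Finset.Icc (0 : ℤ) ((G.Nx : ℤ) - 1), ∀ j ∈ Finset.Icc (0 : ℤ) ((G.Ny : ℤ) - 1),
      G.dxEx (Wx n) i j + G.dyEy (Wy n) i j = 0)

/-- The compact-support condition: the discrete solution vanishes within one mesh
layer of `∂Ω`. -/
def CompactSupp (Wx Wy Z : ℕ → ℤ → ℤ → ℝ) : Prop :=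
  (∀ n : ℕ, ∀ j : ℤ,
    Wx n 0 j = 0 ∧ Wx n 1 j = 0 ∧ Wx n ((G.Nx : ℤ) - 1) j = 0 ∧ Wx n (G.Nx : ℤ) j = 0) ∧
  (∀ n : ℕ, ∀ i : ℤ,
    Wx n i (-1) = 0 ∧ Wx n i 0 = 0 ∧ Wx n i ((G.Ny : ℤ) - 1) = 0 ∧ Wx n i (G.Ny : ℤ) = 0) ∧
  (∀ n : ℕ, ∀ j : ℤ,
    Wy n (-1) j = 0 ∧ Wy n 0 j = 0 ∧ Wy n ((G.Nx : ℤ) - 1) j = 0 ∧ Wy n (G.Nx : ℤ) j = 0) ∧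
  (∀ n : ℕ, ∀ i : ℤ,
    Wy n i 0 = 0 ∧ Wy n i 1 = 0 ∧ Wy n i ((G.Ny : ℤ) - 1) = 0 ∧ Wy n i (G.Ny : ℤ) = 0) ∧
  (∀ n : ℕ, ∀ j : ℤ, Z n 0 j = 0) ∧
  (∀ n : ℕ, ∀ i : ℤ, Z n i 0 = 0)

/-! ### Auxiliary interpolants and consistency functions -/

/-- The auxiliary interpolant `ũ^{x,n}_{i,j+1/2}`, with its boundary extension. -/
def tux (ux : ℝ → ℝ → ℝ → ℝ) (Δt : ℝ) (n : ℕ) (i j : ℤ) : ℝ :=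
  if j = -1 then ux (G.xp i) (G.yp 0) ((n : ℝ) * Δt)
  else if j = (G.Ny : ℤ) then ux (G.xp i) (G.yp (G.Ny : ℤ)) ((n : ℝ) * Δt)
  else (1 / G.kk j) * (∫ y in (G.yp j)..(G.yp (j + 1)), ux (G.xp i) y ((n : ℝ) * Δt))
    - (G.kk j) ^ 2 / 6 * pdy (pdy ux) (G.xp i) (G.yh j) ((n : ℝ) * Δt)

/-- The auxiliary interpolant `ũ^{y,n}_{i+1/2,j}`, with its boundary extension. -/
def tuy (uy : ℝ → ℝ → ℝ → ℝ) (Δt : ℝ) (n : ℕ) (i j : ℤ) : ℝ :=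
  if i = -1 then uy (G.xp 0) (G.yp j) ((n : ℝ) * Δt)
  else if i = (G.Nx : ℤ) then uy (G.xp (G.Nx : ℤ)) (G.yp j) ((n : ℝ) * Δt)
  else (1 / G.hh i) * (∫ x in (G.xp i)..(G.xp (i + 1)), uy x (G.yp j) ((n : ℝ) * Δt))
    - (G.hh i) ^ 2 / 6 * pdx (pdx uy) (G.xh i) (G.yp j) ((n : ℝ) * Δt)

/-- `γ^{x,n}_{i+1/2,j+1/2} = (h_{i+1/2}²/8) ∂²u^x/∂t∂x (x_{i+1/2}, y_{j+1/2}, t^n)`. -/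
def gammax (ux : ℝ → ℝ → ℝ → ℝ) (Δt : ℝ) (n : ℕ) (i j : ℤ) : ℝ :=
  (G.hh i) ^ 2 / 8 * pdt (pdx ux) (G.xh i) (G.yh j) ((n : ℝ) * Δt)

/-- `γ^{y,n}_{i+1/2,j+1/2} = (k_{j+1/2}²/8) ∂²u^y/∂t∂y (x_{i+1/2}, y_{j+1/2}, t^n)`. -/
def gammay (uy : ℝ → ℝ → ℝ → ℝ) (Δt : ℝ) (n : ℕ) (i j : ℤ) : ℝ :=
  (G.kk j) ^ 2 / 8 * pdt (pdy uy) (G.xh i) (G.yh j) ((n : ℝ) * Δt)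

end Grid

/-! ### Averaging (interpolation) operators on a uniform grid -/

/-- `P^x_h` : x-edge function → cell-centered function. -/
def PxEx (f : ℤ → ℤ → ℝ) (i j : ℤ) : ℝ := (f i j + f (i + 1) j) / 2

/-- `P^x_h` : cell-centered function → x-edge function. -/
def PxC (q : ℤ → ℤ → ℝ) (i j : ℤ) : ℝ := (q (i - 1) j + q i j) / 2

/-- `P^x_h` : y-edge function → node function. -/
def PxEyN (f : ℤ → ℤ → ℝ) (i j : ℤ) : ℝ := (f (i - 1) j + f i j) / 2

/-- `P^x_h` : node function → y-edge function. -/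
def PxN (g : ℤ → ℤ → ℝ) (i j : ℤ) : ℝ := (g i j + g (i + 1) j) / 2

/-- `P^y_h` : y-edge function → cell-centered function. -/
def PyEy (f : ℤ → ℤ → ℝ) (i j : ℤ) : ℝ := (f i j + f i (j + 1)) / 2

/-- `P^y_h` : cell-centered function → y-edge function. -/
def PyC (q : ℤ → ℤ → ℝ) (i j : ℤ) : ℝ := (q i (j - 1) + q i j) / 2

/-- `P^y_h` : x-edge function → node function. -/
def PyEx (f : ℤ → ℤ → ℝ) (i j : ℤ) : ℝ := (f i (j - 1) + f i j) / 2

/-- `P^y_h` : node function → x-edge function. -/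
def PyN (g : ℤ → ℤ → ℝ) (i j : ℤ) : ℝ := (g i j + g i (j + 1)) / 2

namespace Grid

variable (G : Grid)

/-- The discrete nonlinear term `α^{x,n}_{i,j+1/2}` of the fully implicit RMAC scheme. -/
def alphaX (Wx Wy : ℤ → ℤ → ℝ) (i j : ℤ) : ℝ :=
  (Wx i j * G.DxC (PxEx Wx) i j
    + PxC (G.dxEx fun a b => (Wx a b) ^ 2) i j
    + PyN (fun a b => PxEyN Wy a b * G.DyEx Wx a b) i j
    + (PyEx Wx i (j + 1) * PxEyN Wy i (j + 1) - PyEx Wx i j * PxEyN Wy i j) / G.kk j) / 2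

/-- The discrete nonlinear term `α^{y,n}_{i+1/2,j}` of the fully implicit RMAC scheme. -/
def alphaY (Wx Wy : ℤ → ℤ → ℝ) (i j : ℤ) : ℝ :=
  (Wy i j * G.DyC (PyEy Wy) i j
    + PyC (G.dyEy fun a b => (Wy a b) ^ 2) i j
    + PxN (fun a b => PyEx Wx a b * G.DxEy Wy a b) i j
    + (PyEx Wx (i + 1) j * PxEyN Wy (i + 1) j - PyEx Wx i j * PxEyN Wy i j) / G.hh i) / 2

/-- The fully implicit RMAC scheme for the Navier–Stokes equations. -/
def IsRMACNS (μ Δt : ℝ) (fx fy Wx Wy Z : ℕ → ℤ → ℤ → ℝ) : Prop :=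
  (∀ n : ℕ, ∀ j : ℤ, Wx n 0 j = 0 ∧ Wx n (G.Nx : ℤ) j = 0) ∧
  (∀ n : ℕ, ∀ i : ℤ, Wx n i (-1) = 0 ∧ Wx n i (G.Ny : ℤ) = 0) ∧
  (∀ n : ℕ, ∀ i : ℤ, Wy n i 0 = 0 ∧ Wy n i (G.Ny : ℤ) = 0) ∧
  (∀ n : ℕ, ∀ j : ℤ, Wy n (-1) j = 0 ∧ Wy n (G.Nx : ℤ) j = 0) ∧
  (∀ i j : ℤ, Wx 0 i j = 0 ∧ Wy 0 i j = 0) ∧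
  (∀ n : ℕ, 1 ≤ n →
    ∀ i ∈ Finset.Icc (1 : ℤ) ((G.Nx : ℤ) - 1), ∀ j ∈ Finset.Icc (0 : ℤ) ((G.Ny : ℤ) - 1),
      (Wx n i j - Wx (n - 1) i j) / Δt
        - μ * ((G.dxEx (Wx n) i j - G.dxEx (Wx n) (i - 1) j) / G.hc i)
        - μ * ((G.DyEx (Wx n) i (j + 1) - G.DyEx (Wx n) i j) / G.kk j)
        + G.alphaX (Wx n) (Wy n) i j
        + G.DxC (Z n) i j = fx n i j) ∧
  (∀ n : ℕ, 1 ≤ n →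
    ∀ i ∈ Finset.Icc (0 : ℤ) ((G.Nx : ℤ) - 1), ∀ j ∈ Finset.Icc (1 : ℤ) ((G.Ny : ℤ) - 1),
      (Wy n i j - Wy (n - 1) i j) / Δt
        - μ * ((G.DxEy (Wy n) (i + 1) j - G.DxEy (Wy n) i j) / G.hh i)
        - μ * ((G.dyEy (Wy n) i j - G.dyEy (Wy n) i (j - 1)) / G.kc j)
        + G.alphaY (Wx n) (Wy n) i j
        + G.DyC (Z n) i j = fy n i j) ∧
  (∀ n : ℕ, 1 ≤ n →
    ∀ i ∈ Finset.Icc (0 : ℤ) ((G.Nx : ℤ) - 1), ∀ j ∈ Finset.Icc (0 : ℤ) ((G.Ny : ℤ) - 1),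
      G.dxEx (Wx n) i j + G.dyEy (Wy n) i j = 0)

/-- A uniform grid with mesh sizes `h` (in x) and `k` (in y). -/
def Uniform (h k : ℝ) : Prop :=
  (∀ i : ℤ, 0 ≤ i → i < G.Nx → G.hh i = h) ∧ (∀ j : ℤ, 0 ≤ j → j < G.Ny → G.kk j = k)

end Grid

end RMAC

namespace RMAC

/-! ### The Poisson problem on a discrete torus -/

lemma sum_add_one_eq {n : ℕ} [NeZero n] (f : ZMod n → ℝ) : ∑ c, f (c + 1) = ∑ c, f c :=
  Equiv.sum_comp (Equiv.addRight (1 : ZMod n)) f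

lemma sum_sub_one_eq {n : ℕ} [NeZero n] (f : ZMod n → ℝ) : ∑ c, f (c - 1) = ∑ c, f c :=
  Equiv.sum_comp (Equiv.subRight (1 : ZMod n)) f

/-- Summation by parts on a cyclic index set. -/
lemma sum_forward_diff_mul {n : ℕ} [NeZero n] (f g : ZMod n → ℝ) :
    ∑ c, (f (c + 1) - f c) * g c = -∑ c, f c * (g c - g (c - 1)) := by
  have h := sum_add_one_eq (fun c => f c * g (c - 1))
  simp only [add_sub_cancel_right] at h
  simp only [sub_mul, mul_sub, sum_sub_distrib, h]
  ring

lemma eq_apply_zero_of_sub_one {n : ℕ} [NeZero n] (f : ZMod n → ℝ)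
    (h : ∀ c, f c = f (c - 1)) (c : ZMod n) : f c = f 0 := by
  have key : ∀ k : ℕ, f (k : ZMod n) = f 0 := by
    intro k
    induction k with
    | zero => simp
    | succ k ih => rw [h, ← ih]; congr 1; push_cast; ring
  rw [← ZMod.natCast_zmod_val c]
  exact key _

/-- The five-point operator of the torus with cell widths `α`, `β` and constant node weights
`ω₁`, `ω₂`. -/
def torusLaplace {n₁ n₂ : ℕ} (α : ZMod n₁ → ℝ) (β : ZMod n₂ → ℝ) (ω₁ ω₂ : ℝ)
    (φ : ZMod n₁ → ZMod n₂ → ℝ) (c : ZMod n₁) (e : ZMod n₂) : ℝ :=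
  ((φ (c + 1) e - φ c e) / ω₁ - (φ c e - φ (c - 1) e) / ω₁) / α c +
    ((φ c (e + 1) - φ c e) / ω₂ - (φ c e - φ c (e - 1)) / ω₂) / β e

section torus

variable {n₁ n₂ : ℕ} [NeZero n₁] [NeZero n₂] {α : ZMod n₁ → ℝ} {β : ZMod n₂ → ℝ} {ω₁ ω₂ : ℝ}

lemma sum_torusLaplace_mul (hα : ∀ c, 0 < α c) (hβ : ∀ e, 0 < β e)
    (φ ψ : ZMod n₁ → ZMod n₂ → ℝ) :
    ∑ c, ∑ e, α c * β e * (torusLaplace α β ω₁ ω₂ φ c e * ψ c e) =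
      -((∑ e, ∑ c, β e * ((φ c e - φ (c - 1) e) / ω₁ * (ψ c e - ψ (c - 1) e))) +
        ∑ c, ∑ e, α c * ((φ c e - φ c (e - 1)) / ω₂ * (ψ c e - ψ c (e - 1)))) := by
  have hx : ∀ e, ∑ c, ((φ (c + 1) e - φ c e) / ω₁ - (φ c e - φ (c - 1) e) / ω₁) * ψ c e =
      -∑ c, (φ c e - φ (c - 1) e) / ω₁ * (ψ c e - ψ (c - 1) e) := by
    intro e
    have := sum_forward_diff_mul (fun c => (φ c e - φ (c - 1) e) / ω₁) (fun c => ψ c e)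
    simpa only [add_sub_cancel_right] using this
  have hy : ∀ c, ∑ e, ((φ c (e + 1) - φ c e) / ω₂ - (φ c e - φ c (e - 1)) / ω₂) * ψ c e =
      -∑ e, (φ c e - φ c (e - 1)) / ω₂ * (ψ c e - ψ c (e - 1)) := by
    intro c
    have := sum_forward_diff_mul (fun e => (φ c e - φ c (e - 1)) / ω₂) (fun e => ψ c e)
    simpa only [add_sub_cancel_right] using this
  have hsplit : ∀ c e, α c * β e * (torusLaplace α β ω₁ ω₂ φ c e * ψ c e) =
      β e * (((φ (c + 1) e - φ c e) / ω₁ - (φ c e - φ (c - 1) e) / ω₁) * ψ c e) +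
      α c * (((φ c (e + 1) - φ c e) / ω₂ - (φ c e - φ c (e - 1)) / ω₂) * ψ c e) := by
    intro c e
    have h1 := (hα c).ne'
    have h2 := (hβ e).ne'
    unfold torusLaplace
    generalize (φ (c + 1) e - φ c e) / ω₁ - (φ c e - φ (c - 1) e) / ω₁ = A
    generalize (φ c (e + 1) - φ c e) / ω₂ - (φ c e - φ c (e - 1)) / ω₂ = B
    field_simp
  simp only [hsplit, sum_add_distrib]
  rw [sum_comm (f := fun c e => β e * _)]
  simp only [← mul_sum, hx, hy]
  simp only [mul_neg, sum_neg_distrib]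
  ring

lemma exists_torusLaplace_eq (hα : ∀ c, 0 < α c) (hβ : ∀ e, 0 < β e) (hω₁ : 0 < ω₁)
    (hω₂ : 0 < ω₂) (q : ZMod n₁ → ZMod n₂ → ℝ) (hq : ∑ c, ∑ e, α c * β e * q c e = 0) :
    ∃ φ : ZMod n₁ → ZMod n₂ → ℝ, ∀ c e, torusLaplace α β ω₁ ω₂ φ c e = q c e := by
  have hmean : ∀ φ : ZMod n₁ → ZMod n₂ → ℝ,
      ∑ c, ∑ e, α c * β e * torusLaplace α β ω₁ ω₂ φ c e = 0 := by
    intro φ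
    have := sum_torusLaplace_mul (ω₁ := ω₁) (ω₂ := ω₂) hα hβ φ (fun _ _ => 1)
    simpa using this
  have hpos : 0 < ∑ c, ∑ e, α c * β e :=
    sum_pos (fun c _ => sum_pos (fun e _ => mul_pos (hα c) (hβ e)) univ_nonempty) univ_nonempty
  let T : (ZMod n₁ → ZMod n₂ → ℝ) →ₗ[ℝ] (ZMod n₁ → ZMod n₂ → ℝ) :=
    { toFun := fun φ c e => torusLaplace α β ω₁ ω₂ φ c e + ∑ c, ∑ e, α c * β e * φ c e
      map_add' := by
        intro φ ψ
        funext c e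
        simp only [torusLaplace, Pi.add_apply, mul_add, sum_add_distrib]
        ring
      map_smul' := by
        intro r φ
        funext c e
        simp only [torusLaplace, Pi.smul_apply, smul_eq_mul, RingHom.id_apply, mul_add, mul_sum]
        congr 1
        · ring
        · exact sum_congr rfl fun _ _ => sum_congr rfl fun _ _ => by ring }
  have hT : ∀ φ c e, T φ c e = torusLaplace α β ω₁ ω₂ φ c e + ∑ c, ∑ e, α c * β e * φ c e :=
    fun _ _ _ => rfl
  have hshift : ∀ (φ ψ : ZMod n₁ → ZMod n₂ → ℝ) (s : ℝ),
      (∀ c e, torusLaplace α β ω₁ ω₂ φ c e + s = ψ c e) →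
      (∑ c, ∑ e, α c * β e * ψ c e = 0) → s = 0 := by
    intro φ ψ s h h0
    simp only [← h, mul_add, sum_add_distrib, hmean, zero_add, ← sum_mul] at h0
    exact (mul_eq_zero.mp h0).resolve_left hpos.ne'
  have hinj : Function.Injective T := by
    rw [← LinearMap.ker_eq_bot, LinearMap.ker_eq_bot']
    intro φ hφ
    have hφ' : ∀ c e, torusLaplace α β ω₁ ω₂ φ c e + (∑ c, ∑ e, α c * β e * φ c e) = 0 := by
      intro c e
      rw [← hT, hφ]; rfl
    have hs := hshift φ (fun _ _ => 0) _ hφ' (by simp)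
    have hzero : ∀ c e, torusLaplace α β ω₁ ω₂ φ c e = 0 := by
      intro c e; have := hφ' c e; rwa [hs, add_zero] at this
    have hE := sum_torusLaplace_mul (ω₁ := ω₁) (ω₂ := ω₂) hα hβ φ φ
    simp only [hzero, zero_mul, mul_zero, sum_const_zero] at hE
    have nx : ∀ e c, 0 ≤ β e * ((φ c e - φ (c - 1) e) / ω₁ * (φ c e - φ (c - 1) e)) := by
      intro e c
      refine mul_nonneg (hβ e).le ?_
      rw [div_mul_eq_mul_div]
      exact div_nonneg (mul_self_nonneg _) hω₁.le
    have ny : ∀ c e, 0 ≤ α c * ((φ c e - φ c (e - 1)) / ω₂ * (φ c e - φ c (e - 1))) := by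
      intro c e
      refine mul_nonneg (hα c).le ?_
      rw [div_mul_eq_mul_div]
      exact div_nonneg (mul_self_nonneg _) hω₂.le
    have sx := sum_nonneg fun e (_ : e ∈ univ) => sum_nonneg fun c (_ : c ∈ univ) => nx e c
    have sy := sum_nonneg fun c (_ : c ∈ univ) => sum_nonneg fun e (_ : e ∈ univ) => ny c e
    have ex := le_antisymm (by linarith) sx
    have ey := le_antisymm (by linarith) sy
    have dx : ∀ c e, φ c e = φ (c - 1) e := by
      intro c e
      rw [sum_eq_zero_iff_of_nonneg (fun e _ => sum_nonneg fun c _ => nx e c)] at ex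
      have h1 := ex e (mem_univ _)
      rw [sum_eq_zero_iff_of_nonneg (fun c _ => nx e c)] at h1
      have h2 := h1 c (mem_univ _)
      have := (hβ e).ne'
      simp [this, hω₁.ne'] at h2
      linarith
    have dy : ∀ c e, φ c e = φ c (e - 1) := by
      intro c e
      rw [sum_eq_zero_iff_of_nonneg (fun c _ => sum_nonneg fun e _ => ny c e)] at ey
      have h1 := ey c (mem_univ _)
      rw [sum_eq_zero_iff_of_nonneg (fun e _ => ny c e)] at h1
      have h2 := h1 e (mem_univ _)
      have := (hα c).ne'
      simp [this, hω₂.ne'] at h2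
      linarith
    have hconst : ∀ c e, φ c e = φ 0 0 := fun c e =>
      (eq_apply_zero_of_sub_one (fun c => φ c e) (fun c => dx c e) c).trans
        (eq_apply_zero_of_sub_one (φ 0) (dy 0) e)
    simp only [hconst, ← sum_mul] at hs
    have h0 := (mul_eq_zero.mp hs).resolve_left hpos.ne'
    funext c e
    rw [hconst, h0]; rfl
  obtain ⟨φ, hφ⟩ := LinearMap.injective_iff_surjective.mp hinj q
  have hφ' : ∀ c e, torusLaplace α β ω₁ ω₂ φ c e + (∑ c, ∑ e, α c * β e * φ c e) = q c e :=
    fun c e => by rw [← hT, hφ]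
  refine ⟨φ, fun c e => ?_⟩
  have := hφ' c e
  rwa [hshift φ q _ hφ' hq, add_zero] at this

/-- A mean-free function on the torus is the divergence of a field whose difference quotients are
all controlled by it. -/
lemma exists_torus_field (hα : ∀ c, 0 < α c) (hβ : ∀ e, 0 < β e) (hω₁ : 0 < ω₁)
    (hω₂ : 0 < ω₂) (q : ZMod n₁ → ZMod n₂ → ℝ) (hq : ∑ c, ∑ e, α c * β e * q c e = 0) :
    ∃ u v : ZMod n₁ → ZMod n₂ → ℝ,
      (∀ c e, (u (c + 1) e - u c e) / α c + (v c (e + 1) - v c e) / β e = q c e) ∧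
      (∑ c, ∑ e, α c * β e * ((u (c + 1) e - u c e) / α c) ^ 2 ≤
        ∑ c, ∑ e, α c * β e * q c e ^ 2) ∧
      (∑ c, ∑ e, α c * β e * ((v c (e + 1) - v c e) / β e) ^ 2 ≤
        ∑ c, ∑ e, α c * β e * q c e ^ 2) ∧
      (ω₁ / ω₂ * ∑ c, ∑ e, (u c e - u c (e - 1)) ^ 2 ≤ ∑ c, ∑ e, α c * β e * q c e ^ 2) ∧
      (ω₂ / ω₁ * ∑ c, ∑ e, (v c e - v (c - 1) e) ^ 2 ≤ ∑ c, ∑ e, α c * β e * q c e ^ 2) ∧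
      (∀ e, ∑ c, u c e = 0) ∧ (∀ c, ∑ e, v c e = 0) := by
  obtain ⟨φ, hφ⟩ := exists_torusLaplace_eq hα hβ hω₁ hω₂ q hq
  let u : ZMod n₁ → ZMod n₂ → ℝ := fun c e => (φ c e - φ (c - 1) e) / ω₁
  let v : ZMod n₁ → ZMod n₂ → ℝ := fun c e => (φ c e - φ c (e - 1)) / ω₂
  have hdiv : ∀ c e, (u (c + 1) e - u c e) / α c + (v c (e + 1) - v c e) / β e = q c e := by
    intro c e
    rw [← hφ c e]
    simp only [u, v, torusLaplace, add_sub_cancel_right]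
  let ψ : ZMod n₁ → ZMod n₂ → ℝ := fun c e => φ c e - φ (c - 1) e - φ c (e - 1) + φ (c - 1) (e - 1)
  have hcross : ∑ c, ∑ e, (u (c + 1) e - u c e) * (v c (e + 1) - v c e) =
      ∑ c, ∑ e, ψ c e ^ 2 / (ω₁ * ω₂) := by
    rw [sum_comm]
    simp only [fun e => sum_forward_diff_mul (fun c => u c e) (fun c => v c (e + 1) - v c e)]
    rw [sum_neg_distrib, sum_comm]
    have h2 : ∀ c, ∑ e, u c e * (v c (e + 1) - v c e - (v (c - 1) (e + 1) - v (c - 1) e)) =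
        -∑ e, ψ c e ^ 2 / (ω₁ * ω₂) := by
      intro c
      have := sum_forward_diff_mul (fun e => v c e - v (c - 1) e) (fun e => u c e)
      rw [show (∑ e, u c e * (v c (e + 1) - v c e - (v (c - 1) (e + 1) - v (c - 1) e))) =
        ∑ e, (v c (e + 1) - v (c - 1) (e + 1) - (v c e - v (c - 1) e)) * u c e from
        sum_congr rfl fun _ _ => by ring, this]
      congr 1
      refine sum_congr rfl fun e _ => ?_
      simp only [u, v, ψ]
      field_simp
      ring
    simp only [h2, sum_neg_distrib, neg_neg]
  have hsum : (∑ c, ∑ e, α c * β e * ((u (c + 1) e - u c e) / α c) ^ 2) +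
      (∑ c, ∑ e, α c * β e * ((v c (e + 1) - v c e) / β e) ^ 2) +
      2 * ∑ c, ∑ e, ψ c e ^ 2 / (ω₁ * ω₂) = ∑ c, ∑ e, α c * β e * q c e ^ 2 := by
    rw [← hcross]
    simp only [mul_sum, ← sum_add_distrib]
    refine sum_congr rfl fun c _ => sum_congr rfl fun e _ => ?_
    have h1 := (hα c).ne'
    have h2 := (hβ e).ne'
    rw [← hdiv]
    field_simp
    ring
  have hψ : 0 ≤ ∑ c, ∑ e, ψ c e ^ 2 / (ω₁ * ω₂) :=
    sum_nonneg fun c _ => sum_nonneg fun e _ => by positivity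
  have hu : 0 ≤ ∑ c, ∑ e, α c * β e * ((u (c + 1) e - u c e) / α c) ^ 2 :=
    sum_nonneg fun c _ => sum_nonneg fun e _ =>
      mul_nonneg (mul_pos (hα c) (hβ e)).le (sq_nonneg _)
  have hv : 0 ≤ ∑ c, ∑ e, α c * β e * ((v c (e + 1) - v c e) / β e) ^ 2 :=
    sum_nonneg fun c _ => sum_nonneg fun e _ =>
      mul_nonneg (mul_pos (hα c) (hβ e)).le (sq_nonneg _)
  refine ⟨u, v, hdiv, by linarith, by linarith, ?_, ?_, ?_, ?_⟩
  · have : ω₁ / ω₂ * ∑ c, ∑ e, (u c e - u c (e - 1)) ^ 2 = ∑ c, ∑ e, ψ c e ^ 2 / (ω₁ * ω₂) := by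
      simp only [mul_sum]
      refine sum_congr rfl fun c _ => sum_congr rfl fun e _ => ?_
      simp only [u, ψ]
      field_simp
      ring
    linarith
  · have : ω₂ / ω₁ * ∑ c, ∑ e, (v c e - v (c - 1) e) ^ 2 = ∑ c, ∑ e, ψ c e ^ 2 / (ω₁ * ω₂) := by
      simp only [mul_sum]
      refine sum_congr rfl fun c _ => sum_congr rfl fun e _ => ?_
      simp only [v, ψ]
      field_simp
      ring
    linarith
  · intro e
    simp only [u, ← sum_div, sum_sub_distrib]
    rw [sum_sub_one_eq (fun c => φ c e), sub_self, zero_div]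
  · intro c
    simp only [v, ← sum_div, sum_sub_distrib]
    rw [sum_sub_one_eq (φ c), sub_self, zero_div]

end torus

/-- A mean-free function on a cyclic index set is controlled by its differences. -/
lemma sum_sq_le_of_sum_eq_zero {n : ℕ} [NeZero n] (w u : ZMod n → ℝ) (hw : ∀ c, 0 < w c)
    (hu : ∑ c, u c = 0) :
    ∑ c, u c ^ 2 ≤ n * (∑ c, w c) * ∑ c, w c * ((u (c + 1) - u c) / w c) ^ 2 := by
  have hle : ∀ a b, u a - u b ≤ ∑ c, |u (c + 1) - u c| := by
    intro a b
    have key : ∀ k : ℕ, k ≤ n → u (b + k) - u b ≤ ∑ j ∈ range k, |u (b + j + 1) - u (b + j)| := by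
      intro k
      induction k with
      | zero => simp
      | succ k ih =>
        intro hk
        rw [sum_range_succ]
        have := ih (by omega)
        have h2 := le_abs_self (u (b + k + 1) - u (b + k))
        push_cast
        rw [← add_assoc]
        linarith
    have hval := ZMod.val_lt (a - b)
    have h1 := key (a - b).val hval.le
    rw [ZMod.natCast_zmod_val, add_sub_cancel] at h1
    refine h1.trans ?_
    have hinj : Set.InjOn (fun j : ℕ => b + (j : ZMod n)) (range (a - b).val) := by
      intro i hi j hj hij
      simp only [coe_range, Set.mem_Iio] at hi hj
      have h := add_left_cancel hij
      have := congrArg ZMod.val h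
      rwa [ZMod.val_natCast_of_lt (by omega), ZMod.val_natCast_of_lt (by omega)] at this
    rw [← sum_image (f := fun c => |u (c + 1) - u c|) hinj]
    exact sum_le_univ_sum_of_nonneg fun _ => abs_nonneg _
  have habs : ∀ a, |u a| ≤ ∑ c, |u (c + 1) - u c| := by
    intro a
    have hn : (0 : ℝ) < n := Nat.cast_pos.mpr (Nat.pos_of_ne_zero (NeZero.ne n))
    have e1 : ∑ b, (u a - u b) = n * u a := by simp [hu, ZMod.card]
    have e2 : ∑ b, (u b - u a) = -(n * u a) := by simp [hu, ZMod.card]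
    have l1 : ∑ b, (u a - u b) ≤ ∑ _b : ZMod n, ∑ c, |u (c + 1) - u c| :=
      sum_le_sum fun b _ => hle a b
    have l2 : ∑ b, (u b - u a) ≤ ∑ _b : ZMod n, ∑ c, |u (c + 1) - u c| :=
      sum_le_sum fun b _ => hle b a
    rw [sum_const, card_univ, ZMod.card, nsmul_eq_mul] at l1 l2
    rw [abs_le]
    constructor <;> refine le_of_mul_le_mul_left ?_ hn <;> linarith
  have hcs : (∑ c, |u (c + 1) - u c|) ^ 2 ≤
      (∑ c, w c) * ∑ c, w c * ((u (c + 1) - u c) / w c) ^ 2 := by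
    refine sum_sq_le_sum_mul_sum_of_sq_le_mul univ (fun c _ => (hw c).le)
      (fun c _ => mul_nonneg (hw c).le (sq_nonneg _)) fun c _ => le_of_eq ?_
    have := (hw c).ne'
    rw [sq_abs]
    field_simp
  calc ∑ c, u c ^ 2 ≤ ∑ _c : ZMod n, (∑ c, w c) * ∑ c, w c * ((u (c + 1) - u c) / w c) ^ 2 := by
        refine sum_le_sum fun c _ => le_trans ?_ hcs
        rw [← sq_abs]
        exact pow_le_pow_left₀ (abs_nonneg _) (habs c) 2
    _ = _ := by rw [sum_const, card_univ, ZMod.card, nsmul_eq_mul, mul_assoc]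

end RMAC

namespace RMAC

/-! ### Quasi-uniform partitions of an interval and a smooth monotone reparametrization -/

/-- `0 = y 0 < y 1 < ⋯ < y N = L` with all steps between `c * H` and `H`. -/
structure QuasiUniform (N : ℕ) (y : ℕ → ℝ) (L H c : ℝ) : Prop where
  one_le : 1 ≤ N
  c_pos : 0 < c
  H_pos : 0 < H
  zero : y 0 = 0
  last : y N = L
  lower : ∀ j < N, c * H ≤ y (j + 1) - y j
  upper : ∀ j < N, y (j + 1) - y j ≤ H

/-- The cubic that fixes `0`, `L / 2`, `L` and has slope `2` at both ends of `[0, L]`. -/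
def bend (L t : ℝ) : ℝ := 2 * t - 3 * t ^ 2 / L + 2 * t ^ 3 / L ^ 2

/-- The slope of the chord of `bend L` over `[a, b]`. -/
def bendSlope (L a b : ℝ) : ℝ := 2 - 3 * (a + b) / L + 2 * (a ^ 2 + a * b + b ^ 2) / L ^ 2

lemma bend_sub {L : ℝ} (hL : 0 < L) (a b : ℝ) :
    bend L b - bend L a = (b - a) * bendSlope L a b := by
  unfold bend bendSlope
  field_simp
  ring

lemma bendSlope_le {L a b : ℝ} (hL : 0 < L) (ha : 0 ≤ a) (haL : a ≤ L) (hb : 0 ≤ b)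
    (hbL : b ≤ L) : bendSlope L a b ≤ 2 := by
  have : 2 * (a ^ 2 + a * b + b ^ 2) / L ^ 2 ≤ 3 * (a + b) / L := by
    rw [div_le_div_iff₀ (by positivity) hL]
    have h : 2 * (a ^ 2 + a * b + b ^ 2) ≤ 3 * (a + b) * L := by nlinarith
    calc 2 * (a ^ 2 + a * b + b ^ 2) * L ≤ 3 * (a + b) * L * L := by gcongr
      _ = _ := by ring
  unfold bendSlope
  linarith

lemma half_le_bendSlope {L : ℝ} (hL : 0 < L) (a b : ℝ) : 1 / 2 ≤ bendSlope L a b := by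
  have : bendSlope L a b - 1 / 2 = (3 / 2 * (L - a - b) ^ 2 + (a - b) ^ 2 / 2) / L ^ 2 := by
    unfold bendSlope
    field_simp
    ring
  have h2 : 0 ≤ (3 / 2 * (L - a - b) ^ 2 + (a - b) ^ 2 / 2) / L ^ 2 := by positivity
  linarith

lemma abs_bendSlope_sub_le {L a b d H : ℝ} (hL : 0 < L) (ha : 0 ≤ a) (hdL : d ≤ L)
    (hab : a ≤ b) (hbd : b ≤ d) (h1 : b - a ≤ H) (h2 : d - b ≤ H) :
    |bendSlope L b d - bendSlope L a b| ≤ 6 * (H / L) := by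
  have e : bendSlope L b d - bendSlope L a b = (d - a) / L * (2 * (a + b + d) / L - 3) := by
    unfold bendSlope
    field_simp
    ring
  have h3 : |2 * (a + b + d) / L - 3| ≤ 3 := by
    have : 2 * (a + b + d) / L ≤ 6 := by
      rw [div_le_iff₀ hL]; linarith
    have h0 : 0 ≤ 2 * (a + b + d) / L := div_nonneg (by linarith) hL.le
    rw [abs_le]; constructor <;> linarith
  have h4 : 0 ≤ (d - a) / L := div_nonneg (by linarith) hL.le
  have h6 : 0 ≤ H / L := div_nonneg (by linarith) hL.le
  have h5 : (d - a) / L ≤ 2 * (H / L) := by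
    rw [← mul_div_assoc]; gcongr; linarith
  rw [e, abs_mul, abs_of_nonneg h4]
  calc (d - a) / L * |2 * (a + b + d) / L - 3| ≤ 2 * (H / L) * 3 := by gcongr
    _ = _ := by ring

lemma abs_bendSlope_zero_sub_le {L b H : ℝ} (hL : 0 < L) (hb : 0 ≤ b) (hbL : b ≤ L)
    (hbH : b ≤ H) : |bendSlope L 0 b - 2| ≤ 3 * (H / L) := by
  have e : bendSlope L 0 b - 2 = b / L * (2 * b / L - 3) := by
    unfold bendSlope
    field_simp
    ring
  have h3 : |2 * b / L - 3| ≤ 3 := by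
    have : 2 * b / L ≤ 2 := by rw [div_le_iff₀ hL]; linarith
    have h0 : 0 ≤ 2 * b / L := by positivity
    rw [abs_le]; constructor <;> linarith
  have h4 : 0 ≤ H / L := div_nonneg (by linarith) hL.le
  rw [e, abs_mul, abs_of_nonneg (by positivity)]
  calc b / L * |2 * b / L - 3| ≤ H / L * 3 := by gcongr
    _ = _ := by ring

lemma abs_bendSlope_last_sub_le {L a H : ℝ} (hL : 0 < L) (ha : 0 ≤ a) (haL : a ≤ L)
    (haH : L - a ≤ H) : |bendSlope L a L - 2| ≤ 3 * (H / L) := by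
  have e : bendSlope L a L = bendSlope L 0 (L - a) := by
    unfold bendSlope
    field_simp
    ring
  rw [e]
  exact abs_bendSlope_zero_sub_le hL (by linarith) (by linarith) haH

/-- The length of `[0, t] ∩ [y m, y (m + 1)]`. -/
def covered (y : ℕ → ℝ) (t : ℝ) (m : ℕ) : ℝ := min t (y (m + 1)) - min t (y m)

/-- The length of the part of the cell `m` inside the image under `bend L` of the cell `j`. -/
def overlap (L : ℝ) (y : ℕ → ℝ) (j m : ℕ) : ℝ :=
  covered y (bend L (y (j + 1))) m - covered y (bend L (y j)) m

/-- The number of cells or nodes of the partition that interact with a given one. -/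
def mult (c : ℝ) : ℝ := 12 / c + 1

lemma card_filter_abs_sub_le {N : ℕ} {z : ℕ → ℝ} {d R : ℝ} (hd : 0 < d) (hR : 0 ≤ R)
    (hz : ∀ i j, i ≤ j → j ≤ N → d * ((j : ℝ) - i) ≤ z j - z i) (t : ℝ) :
    (((range (N + 1)).filter fun j => |z j - t| ≤ R).card : ℝ) ≤ 2 * R / d + 1 := by
  set s := (range (N + 1)).filter fun j => |z j - t| ≤ R with hs
  rcases s.eq_empty_or_nonempty with h | h
  · rw [h]; simp; positivity
  have ha := mem_filter.mp (s.min'_mem h)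
  have hb := mem_filter.mp (s.max'_mem h)
  have hab : s.min' h ≤ s.max' h := s.min'_le_max' h
  have hsub : s ⊆ Icc (s.min' h) (s.max' h) := fun x hx =>
    mem_Icc.mpr ⟨s.min'_le x hx, s.le_max' x hx⟩
  have hcard := card_le_card hsub
  rw [Nat.card_Icc] at hcard
  have h1 : (s.card : ℝ) ≤ (s.max' h : ℝ) - s.min' h + 1 := by
    have : s.card + s.min' h ≤ s.max' h + 1 := by omega
    have : (s.card : ℝ) + s.min' h ≤ s.max' h + 1 := by exact_mod_cast this
    linarith
  have h2 := hz _ _ hab (by have := mem_range.mp hb.1; omega)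
  have h3 := abs_le.mp ha.2
  have h4 := abs_le.mp hb.2
  have h5 : (s.max' h : ℝ) - s.min' h ≤ 2 * R / d := by
    rw [le_div_iff₀ hd]; nlinarith
  linarith

namespace QuasiUniform

variable {N : ℕ} {y : ℕ → ℝ} {L H c : ℝ}

lemma step_pos (Q : QuasiUniform N y L H c) {j : ℕ} (hj : j < N) : 0 < y (j + 1) - y j :=
  (mul_pos Q.c_pos Q.H_pos).trans_le (Q.lower j hj)

lemma mul_le_sub (Q : QuasiUniform N y L H c) {i j : ℕ} (hij : i ≤ j) (hj : j ≤ N) :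
    c * H * ((j : ℝ) - i) ≤ y j - y i := by
  induction j, hij using Nat.le_induction with
  | base => simp
  | succ j hij ih =>
    have := ih (by omega)
    have := Q.lower j (by omega)
    push_cast
    linarith

lemma mono (Q : QuasiUniform N y L H c) {i j : ℕ} (hij : i ≤ j) (hj : j ≤ N) : y i ≤ y j := by
  have h := Q.mul_le_sub hij hj
  have : 0 ≤ c * H * ((j : ℝ) - i) :=
    mul_nonneg (mul_pos Q.c_pos Q.H_pos).le (sub_nonneg.mpr (by exact_mod_cast hij))
  linarith

lemma nonneg (Q : QuasiUniform N y L H c)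
    {j : ℕ} (hj : j ≤ N) : 0 ≤ y j := Q.zero ▸ Q.mono (Nat.zero_le j) hj

lemma le_last (Q : QuasiUniform N y L H c)
    {j : ℕ} (hj : j ≤ N) : y j ≤ L := Q.last ▸ Q.mono hj le_rfl

lemma L_pos (Q : QuasiUniform N y L H c) : 0 < L := by
  have h0 := Q.step_pos (j := 0) Q.one_le
  have := Q.le_last Q.one_le
  rw [Q.zero] at h0
  simp only [zero_add] at h0
  linarith

lemma one_le_mult (Q : QuasiUniform N y L H c) : 1 ≤ mult c := by
  have := Q.c_pos
  unfold mult
  have : 0 ≤ 12 / c := by positivity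
  linarith

lemma bend_zero (Q : QuasiUniform N y L H c) : bend L (y 0) = 0 := by simp [Q.zero, bend]

lemma bend_last (Q : QuasiUniform N y L H c) : bend L (y N) = L := by
  have := Q.L_pos
  rw [Q.last, bend]
  field_simp
  ring

lemma half_sub_le_bend_sub (Q : QuasiUniform N y L H c) {i j : ℕ} (hij : i ≤ j) (hj : j ≤ N) :
    (y j - y i) / 2 ≤ bend L (y j) - bend L (y i) := by
  rw [bend_sub Q.L_pos]
  have := half_le_bendSlope Q.L_pos (y i) (y j)
  have := Q.mono hij hj
  nlinarith

lemma bend_mono (Q : QuasiUniform N y L H c)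
    {i j : ℕ} (hij : i ≤ j) (hj : j ≤ N) : bend L (y i) ≤ bend L (y j) := by
  have := Q.half_sub_le_bend_sub hij hj
  have := Q.mono hij hj
  linarith

lemma bend_step_le (Q : QuasiUniform N y L H c)
    {j : ℕ} (hj : j < N) : bend L (y (j + 1)) - bend L (y j) ≤ 2 * H := by
  rw [bend_sub Q.L_pos]
  have h1 := bendSlope_le Q.L_pos (Q.nonneg hj.le) (Q.le_last hj.le) (Q.nonneg hj) (Q.le_last hj)
  have h2 := Q.step_pos hj
  have h3 := Q.upper j hj
  nlinarith

lemma bend_mem (Q : QuasiUniform N y L H c)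
    {j : ℕ} (hj : j ≤ N) : 0 ≤ bend L (y j) ∧ bend L (y j) ≤ L := by
  have h1 := Q.bend_mono (Nat.zero_le j) hj
  have h2 := Q.bend_mono hj le_rfl
  rw [Q.bend_zero] at h1
  rw [Q.bend_last] at h2
  exact ⟨h1, h2⟩

lemma card_node_near_le (Q : QuasiUniform N y L H c) (t : ℝ) :
    (((range (N + 1)).filter fun m => |y m - t| ≤ 3 * H).card : ℝ) ≤ mult c := by
  have hc := Q.c_pos
  have hH := Q.H_pos
  refine (card_filter_abs_sub_le (mul_pos hc hH) (by positivity)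
    (fun i j => Q.mul_le_sub) t).trans ?_
  unfold mult
  have : 2 * (3 * H) / (c * H) = 6 / c := by field_simp; ring
  rw [this]
  gcongr
  norm_num

lemma card_bend_near_le (Q : QuasiUniform N y L H c) (t : ℝ) :
    (((range (N + 1)).filter fun j => |bend L (y j) - t| ≤ 3 * H).card : ℝ) ≤ mult c := by
  have hc := Q.c_pos
  have hH := Q.H_pos
  refine (card_filter_abs_sub_le (d := c * H / 2) (by positivity) (by positivity)
    (fun i j hij hj => ?_) t).trans ?_
  · have h1 := Q.mul_le_sub hij hj
    have h2 := Q.half_sub_le_bend_sub hij hj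
    linarith
  · unfold mult
    have : 2 * (3 * H) / (c * H / 2) = 12 / c := by field_simp; ring
    rw [this]

/-- Summing over the nodes near the image of each node counts every node boundedly often. -/
lemma sum_sum_near_le (Q : QuasiUniform N y L H c) (s : Finset ℕ) (f : ℕ → ℝ) (hf : ∀ m, 0 ≤ f m) :
    ∑ j ∈ range (N + 1), ∑ m ∈ s.filter (fun m => |y m - bend L (y j)| ≤ 3 * H), f m ≤
      mult c * ∑ m ∈ s, f m := by
  simp only [sum_filter]
  rw [sum_comm, mul_sum]
  refine sum_le_sum fun m _ => ?_
  rw [← sum_filter, sum_const, nsmul_eq_mul]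
  refine mul_le_mul_of_nonneg_right ?_ (hf m)
  simpa only [abs_sub_comm] using Q.card_bend_near_le (y m)

lemma sum_covered (Q : QuasiUniform N y L H c)
    {t : ℝ} (h0 : 0 ≤ t) (hL : t ≤ L) : ∑ m ∈ range N, covered y t m = t := by
  unfold covered
  rw [sum_range_sub (fun m => min t (y m)), Q.last, Q.zero, min_eq_left hL, min_eq_right h0,
    sub_zero]

lemma sum_overlap (Q : QuasiUniform N y L H c) {j : ℕ} (hj : j < N) :
    ∑ m ∈ range N, overlap L y j m = (y (j + 1) - y j) * bendSlope L (y j) (y (j + 1)) := by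
  unfold overlap
  have h1 := Q.bend_mem (j := j + 1) hj
  have h2 := Q.bend_mem (j := j) hj.le
  rw [sum_sub_distrib, Q.sum_covered h1.1 h1.2, Q.sum_covered h2.1 h2.2, bend_sub Q.L_pos]

lemma overlap_nonneg (Q : QuasiUniform N y L H c)
    {j m : ℕ} (hj : j < N) (hm : m < N) : 0 ≤ overlap L y j m := by
  have h1 := Q.bend_mono (Nat.le_succ j) hj
  have h2 := (Q.step_pos hm).le
  unfold overlap covered
  rcases min_cases (bend L (y (j + 1))) (y (m + 1)) with ⟨e1, l1⟩ | ⟨e1, l1⟩ <;>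
  rcases min_cases (bend L (y (j + 1))) (y m) with ⟨e2, l2⟩ | ⟨e2, l2⟩ <;>
  rcases min_cases (bend L (y j)) (y (m + 1)) with ⟨e3, l3⟩ | ⟨e3, l3⟩ <;>
  rcases min_cases (bend L (y j)) (y m) with ⟨e4, l4⟩ | ⟨e4, l4⟩ <;>
  rw [e1, e2, e3, e4] <;> simp only [Nat.succ_eq_add_one] at * <;> linarith

lemma overlap_eq_zero (Q : QuasiUniform N y L H c) {j m : ℕ} (hj : j < N) (hm : m < N)
    (h : y (m + 1) < bend L (y j) ∨ bend L (y (j + 1)) < y m) : overlap L y j m = 0 := by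
  have h1 := Q.bend_mono (Nat.le_succ j) hj
  have h2 := (Q.step_pos hm).le
  simp only [Nat.succ_eq_add_one] at h1
  unfold overlap covered
  rcases h with h | h
  · rw [min_eq_right (by linarith), min_eq_right (by linarith), min_eq_right (by linarith),
      min_eq_right (by linarith)]
    ring
  · rw [min_eq_left (by linarith), min_eq_left (by linarith), min_eq_left (by linarith),
      min_eq_left (by linarith)]
    ring

/-- Averaging over the image of the cell `j` only sees the values at cells near its end node
`a`. -/
lemma abs_sum_overlap_sub_le (Q : QuasiUniform N y L H c)
    {j a : ℕ} (hj : j < N) (ha : a = j ∨ a = j + 1) (f : ℕ → ℝ)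
    (r S : ℝ) (hf : ∀ m < N, |y m - bend L (y a)| ≤ 3 * H → |f m - r| ≤ S) :
    |1 / (y (j + 1) - y j) * ∑ m ∈ range N, overlap L y j m * f m -
      bendSlope L (y j) (y (j + 1)) * r| ≤ bendSlope L (y j) (y (j + 1)) * S := by
  have hk := Q.step_pos hj
  have hH := Q.H_pos
  have e : 1 / (y (j + 1) - y j) * ∑ m ∈ range N, overlap L y j m * f m -
      bendSlope L (y j) (y (j + 1)) * r =
      1 / (y (j + 1) - y j) * ∑ m ∈ range N, overlap L y j m * (f m - r) := by
    simp only [mul_sub, sum_sub_distrib, ← sum_mul]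
    rw [Q.sum_overlap hj]
    field_simp
  have hb : |∑ m ∈ range N, overlap L y j m * (f m - r)| ≤
      ∑ m ∈ range N, overlap L y j m * S := by
    refine (abs_sum_le_sum_abs _ _).trans (sum_le_sum fun m hm => ?_)
    have hm := mem_range.mp hm
    by_cases h : y (m + 1) < bend L (y j) ∨ bend L (y (j + 1)) < y m
    · simp [Q.overlap_eq_zero hj hm h]
    · push Not at h
      rw [abs_mul, abs_of_nonneg (Q.overlap_nonneg hj hm)]
      refine mul_le_mul_of_nonneg_left (hf m hm ?_) (Q.overlap_nonneg hj hm)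
      have h1 := Q.bend_step_le hj
      have h2 := Q.upper m hm
      have h3 := Q.bend_mono (Nat.le_succ j) hj
      simp only [Nat.succ_eq_add_one] at h3
      rcases ha with rfl | rfl <;> rw [abs_le] <;> constructor <;> linarith
  rw [e, abs_mul, abs_of_pos (by positivity)]
  rw [← sum_mul, Q.sum_overlap hj] at hb
  calc 1 / (y (j + 1) - y j) * |∑ m ∈ range N, overlap L y j m * (f m - r)|
      ≤ 1 / (y (j + 1) - y j) * ((y (j + 1) - y j) * bendSlope L (y j) (y (j + 1)) * S) := by
        gcongr
    _ = _ := by field_simp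

lemma exists_cell (Q : QuasiUniform N y L H c)
    {t : ℝ} (h0 : 0 ≤ t) (hL : t ≤ L) : ∃ m < N, y m ≤ t ∧ t ≤ y (m + 1) := by
  have key : ∀ n ≤ N, t ≤ y n → 0 < n → ∃ m < N, y m ≤ t ∧ t ≤ y (m + 1) := by
    intro n
    induction n with
    | zero => intro _ _ h; omega
    | succ n ih =>
      intro hn ht _
      by_cases h : y n ≤ t
      · exact ⟨n, by omega, h, ht⟩
      · rcases Nat.eq_zero_or_pos n with rfl | hpos
        · exact absurd (Q.zero.le.trans h0) h
        · exact ih (by omega) (not_le.mp h).le hpos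
  exact key N le_rfl (Q.last ▸ hL) Q.one_le

/-- Piecewise linear interpolation at `t` only sees the values at the two nodes next to `t`. -/
lemma abs_interpolate_le (Q : QuasiUniform N y L H c)
    {t : ℝ} (h0 : 0 ≤ t) (hL : t ≤ L) (f : ℕ → ℝ) (S : ℝ)
    (hf : ∀ m ≤ N, |y m - t| ≤ 3 * H → |f m| ≤ S) :
    |f 0 + ∑ m ∈ range N, covered y t m / (y (m + 1) - y m) * (f (m + 1) - f m)| ≤ S := by
  obtain ⟨M, hM, h1, h2⟩ := Q.exists_cell h0 hL
  have hH := Q.H_pos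
  have hk := Q.step_pos hM
  have hu := Q.upper M hM
  have hlow : ∀ n ≤ M, f 0 +
      ∑ m ∈ range n, covered y t m / (y (m + 1) - y m) * (f (m + 1) - f m) = f n := by
    intro n
    induction n with
    | zero => simp
    | succ n ih =>
      intro hn
      rw [sum_range_succ, ← add_assoc, ih (by omega)]
      have a1 := Q.mono (i := n + 1) (j := M) hn hM.le
      have a2 := Q.step_pos (j := n) (by omega)
      unfold covered
      rw [min_eq_right (by linarith), min_eq_right (by linarith), div_self a2.ne']
      ring
  have hhigh : ∀ n, M + 1 ≤ n → n ≤ N → f 0 +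
      ∑ m ∈ range n, covered y t m / (y (m + 1) - y m) * (f (m + 1) - f m) =
      f M + (t - y M) / (y (M + 1) - y M) * (f (M + 1) - f M) := by
    intro n hn
    induction n, hn using Nat.le_induction with
    | base =>
      intro _
      rw [sum_range_succ, ← add_assoc, hlow M le_rfl]
      unfold covered
      rw [min_eq_left h2, min_eq_right h1]
    | succ n hn ih =>
      intro hnN
      rw [sum_range_succ, ← add_assoc, ih (by omega)]
      have a1 := Q.mono (i := M + 1) (j := n) hn (by omega)
      have a2 := Q.step_pos (j := n) (by omega)
      unfold covered
      rw [min_eq_left (by linarith), min_eq_left (by linarith)]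
      ring
  rw [hhigh N hM le_rfl]
  have b1 := abs_le.mp (hf M hM.le (by rw [abs_le]; constructor <;> linarith))
  have b2 := abs_le.mp (hf (M + 1) hM (by rw [abs_le]; constructor <;> linarith))
  set θ := (t - y M) / (y (M + 1) - y M) with hθ
  have t0 : 0 ≤ θ := div_nonneg (by linarith) hk.le
  have t1 : θ ≤ 1 := by rw [hθ, div_le_one hk]; linarith
  rw [abs_le]
  constructor <;> nlinarith

end QuasiUniform

end RMAC

namespace RMAC

/-! ### Folding functions on the double of an interval

The double of a partition with `N` cells has cells and nodes indexed by `ZMod (2 * N)`: cell `j` and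
node `j` of the partition, and their mirror images, cell `-1 - j` and node `-j`. Folding turns a
function on the double into one on the partition with zero boundary values. -/

/-- Folding of a function on the cells. -/
def foldCell (N : ℕ) (y : ℕ → ℝ) (L : ℝ) (j : ℕ) : (ZMod (2 * N) → ℝ) →ₗ[ℝ] ℝ :=
  LinearMap.proj (j : ZMod (2 * N)) + (3 : ℝ) • LinearMap.proj (-1 - j : ZMod (2 * N)) -
    (2 : ℝ) • (1 / (y (j + 1) - y j)) •
      ∑ m ∈ range N, overlap L y j m • LinearMap.proj (-1 - m : ZMod (2 * N))

/-- Folding of a function on the nodes. -/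
def foldNode (N : ℕ) (y : ℕ → ℝ) (L : ℝ) (j : ℕ) : (ZMod (2 * N) → ℝ) →ₗ[ℝ] ℝ :=
  LinearMap.proj (j : ZMod (2 * N)) - (3 : ℝ) • LinearMap.proj (-j : ZMod (2 * N)) +
    (2 : ℝ) • (LinearMap.proj (0 : ZMod (2 * N)) +
      ∑ m ∈ range N, (covered y (bend L (y j)) m / (y (m + 1) - y m)) •
        ((LinearMap.proj (-(m + 1) : ZMod (2 * N)) : (ZMod (2 * N) → ℝ) →ₗ[ℝ] ℝ) -
          LinearMap.proj (-m : ZMod (2 * N))))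

/-- The jump of a folded cell function at the node `j`, with zero values outside the interval. -/
def foldJump (N : ℕ) (y : ℕ → ℝ) (L : ℝ) (j : ℕ) : (ZMod (2 * N) → ℝ) →ₗ[ℝ] ℝ :=
  (if j < N then foldCell N y L j else 0) - (if j = 0 then 0 else foldCell N y L (j - 1))

lemma foldCell_apply (N : ℕ) (y : ℕ → ℝ) (L : ℝ) (j : ℕ) (g : ZMod (2 * N) → ℝ) :
    foldCell N y L j g = g j + 3 * g (-1 - j) -
      2 * (1 / (y (j + 1) - y j) * ∑ m ∈ range N, overlap L y j m * g (-1 - m)) := by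
  simp [foldCell, LinearMap.sum_apply]

lemma foldNode_apply (N : ℕ) (y : ℕ → ℝ) (L : ℝ) (j : ℕ) (u : ZMod (2 * N) → ℝ) :
    foldNode N y L j u = u j - 3 * u (-j) +
      2 * (u 0 + ∑ m ∈ range N, covered y (bend L (y j)) m / (y (m + 1) - y m) *
        (u (-(m + 1)) - u (-m))) := by
  simp [foldNode, LinearMap.sum_apply, mul_add]

/-- Linear functionals in different variables commute. -/
lemma apply_apply_comm {ι κ : Type*} [Fintype ι] [Fintype κ] [DecidableEq ι] [DecidableEq κ]
    (A : (ι → ℝ) →ₗ[ℝ] ℝ) (B : (κ → ℝ) →ₗ[ℝ] ℝ) (F : ι → κ → ℝ) :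
    A (fun i => B (F i)) = B (fun k => A (fun i => F i k)) := by
  obtain ⟨a, ha⟩ : ∃ a : ι → ℝ, ∀ f, A f = ∑ i, f i * a i :=
    ⟨_, fun f => LinearMap.pi_apply_eq_sum_univ A f⟩
  obtain ⟨b, hb⟩ : ∃ b : κ → ℝ, ∀ f, B f = ∑ k, f k * b k :=
    ⟨_, fun f => LinearMap.pi_apply_eq_sum_univ B f⟩
  simp only [ha, hb, sum_mul]
  rw [sum_comm]
  exact sum_congr rfl fun _ _ => sum_congr rfl fun _ _ => by ring

lemma sum_range_natCast_le {n M : ℕ} [NeZero n] (hM : M ≤ n) (f : ZMod n → ℝ)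
    (hf : ∀ c, 0 ≤ f c) : ∑ j ∈ range M, f j ≤ ∑ c, f c := by
  have hinj : Set.InjOn (fun j : ℕ => (j : ZMod n)) (range M) := by
    intro i hi j hj hij
    simp only [coe_range, Set.mem_Iio] at hi hj
    have := congrArg ZMod.val hij
    rwa [ZMod.val_natCast_of_lt (by omega), ZMod.val_natCast_of_lt (by omega)] at this
  rw [← sum_image (f := f) hinj]
  exact sum_le_univ_sum_of_nonneg hf

lemma sum_range_neg_natCast_le {n M : ℕ} [NeZero n] (hM : M ≤ n) (f : ZMod n → ℝ)
    (hf : ∀ c, 0 ≤ f c) : ∑ j ∈ range M, f (-j) ≤ ∑ c, f c :=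
  (sum_range_natCast_le hM (fun c => f (-c)) fun _ => hf _).trans_eq
    (Equiv.sum_comp (Equiv.neg (ZMod n)) f)

lemma sum_range_neg_one_sub_natCast_le {n M : ℕ} [NeZero n] (hM : M ≤ n) (f : ZMod n → ℝ)
    (hf : ∀ c, 0 ≤ f c) : ∑ j ∈ range M, f (-1 - j) ≤ ∑ c, f c :=
  (sum_range_natCast_le hM (fun c => f (-1 - c)) fun _ => hf _).trans_eq
    (Equiv.sum_comp (Equiv.subLeft (-1 : ZMod n)) f)

lemma abs_le_sqrt_sum_sq {s : Finset ℕ} {f : ℕ → ℝ} {m : ℕ} (hm : m ∈ s) :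
    |f m| ≤ √(∑ i ∈ s, f i ^ 2) := by
  rw [← Real.sqrt_sq_eq_abs]
  exact Real.sqrt_le_sqrt (single_le_sum (f := fun i => f i ^ 2) (fun _ _ => sq_nonneg _) hm)

lemma neg_natCast_self_two_mul (N : ℕ) : (-(N : ZMod (2 * N))) = N := by
  have h : ((2 * N : ℕ) : ZMod (2 * N)) = 0 := ZMod.natCast_self _
  push_cast at h
  linear_combination -h

namespace QuasiUniform

variable {N : ℕ} {y : ℕ → ℝ} {L H c : ℝ}

lemma foldNode_zero (Q : QuasiUniform N y L H c)
    (u : ZMod (2 * N) → ℝ) : foldNode N y L 0 u = 0 := by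
  rw [foldNode_apply, sum_eq_zero]
  · simp; ring
  · intro m hm
    have hm := mem_range.mp hm
    rw [Q.bend_zero, covered, min_eq_left (Q.nonneg hm), min_eq_left (Q.nonneg hm.le)]
    simp

lemma foldNode_last (Q : QuasiUniform N y L H c)
    (u : ZMod (2 * N) → ℝ) : foldNode N y L N u = 0 := by
  have : ∑ m ∈ range N, covered y (bend L (y N)) m / (y (m + 1) - y m) *
      (u (-(m + 1)) - u (-m)) = u (-N) - u 0 := by
    rw [← neg_zero, ← Nat.cast_zero (R := ZMod (2 * N)),
      ← sum_range_sub (fun m : ℕ => u (-(m : ZMod (2 * N)))) N]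
    refine sum_congr rfl fun m hm => ?_
    have hm := mem_range.mp hm
    rw [Q.bend_last, covered, min_eq_right (Q.le_last hm), min_eq_right (Q.le_last hm.le),
      div_self (Q.step_pos hm).ne', one_mul, Nat.cast_succ]
  rw [foldNode_apply, this, neg_natCast_self_two_mul]
  ring

/-- Folding commutes with difference quotients. -/
lemma foldNode_succ_sub (Q : QuasiUniform N y L H c)
    {w : ZMod (2 * N) → ℝ} (hw : ∀ j < N, w j = y (j + 1) - y j)
    (hw' : ∀ j < N, w (-1 - j) = y (j + 1) - y j) (u : ZMod (2 * N) → ℝ) {j : ℕ} (hj : j < N) :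
    foldNode N y L (j + 1) u - foldNode N y L j u =
      (y (j + 1) - y j) * foldCell N y L j (fun e => (u (e + 1) - u e) / w e) := by
  have hk := (Q.step_pos hj).ne'
  have hmirror : ∀ m : ℕ, (-1 - m + 1 : ZMod (2 * N)) = -m := fun m => by ring
  have hmirror' : ∀ m : ℕ, (-1 - m : ZMod (2 * N)) = -(m + 1) := fun m => by ring
  have e : ∑ m ∈ range N, overlap L y j m *
      ((u (-1 - m + 1) - u (-1 - m)) / w (-1 - m)) =
      ∑ m ∈ range N, covered y (bend L (y j)) m / (y (m + 1) - y m) *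
        (u (-(m + 1)) - u (-m)) -
      ∑ m ∈ range N, covered y (bend L (y (j + 1))) m / (y (m + 1) - y m) *
        (u (-(m + 1)) - u (-m)) := by
    rw [← sum_sub_distrib]
    refine sum_congr rfl fun m hm => ?_
    rw [hw' m (mem_range.mp hm), hmirror, hmirror', overlap]
    ring
  rw [foldNode_apply, foldNode_apply, foldCell_apply, e, hw j hj, hw' j hj, hmirror, hmirror']
  push_cast
  field_simp
  ring

/-- A square-sum bound for quantities controlled by nearby values of a function on the double. -/
lemma sum_sq_fold_le (Q : QuasiUniform N y L H c)
    {M : ℕ} (hM : M ≤ N + 1) [NeZero (2 * N)] (g g₁ : ZMod (2 * N) → ℝ)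
    (P : ℕ → ℝ) (f : ℕ → ℝ) (hf : ∑ m ∈ range (N + 1), f m ^ 2 ≤ ∑ e, g e ^ 2)
    (h₁ : ∑ e, g₁ e ^ 2 = ∑ e, g e ^ 2)
    (hP : ∀ j < M, |P j| ≤ |g j| + 3 * |g₁ j| + 4 *
      √(∑ m ∈ (range (N + 1)).filter (fun m => |y m - bend L (y j)| ≤ 3 * H), f m ^ 2)) :
    ∑ j ∈ range M, P j ^ 2 ≤ 78 * mult c * ∑ e, g e ^ 2 := by
  have hN := Q.one_le
  have hK := Q.one_le_mult
  set T : ℕ → ℝ := fun j =>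
    ∑ m ∈ (range (N + 1)).filter (fun m => |y m - bend L (y j)| ≤ 3 * H), f m ^ 2 with hT
  have hT0 : ∀ j, 0 ≤ T j := fun j => sum_nonneg fun _ _ => sq_nonneg _
  have hsq : ∀ j < M, P j ^ 2 ≤ 3 * g j ^ 2 + 27 * g₁ j ^ 2 + 48 * T j := by
    intro j hj
    have h := hP j hj
    have h2 : P j ^ 2 ≤ (|g j| + 3 * |g₁ j| + 4 * √(T j)) ^ 2 := by
      rw [← sq_abs]; exact pow_le_pow_left₀ (abs_nonneg _) h 2
    have e1 := sq_abs (g j)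
    have e2 := sq_abs (g₁ j)
    have e3 := Real.sq_sqrt (hT0 j)
    nlinarith [sq_nonneg (|g j| - 3 * |g₁ j|), sq_nonneg (|g j| - 4 * √(T j)),
      sq_nonneg (3 * |g₁ j| - 4 * √(T j))]
  have s1 := sum_range_natCast_le (n := 2 * N) (M := M) (by omega) (fun e => g e ^ 2)
    fun _ => sq_nonneg _
  have s2 := sum_range_natCast_le (n := 2 * N) (M := M) (by omega) (fun e => g₁ e ^ 2)
    fun _ => sq_nonneg _
  have s3 : ∑ j ∈ range M, T j ≤ mult c * ∑ e, g e ^ 2 := by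
    calc ∑ j ∈ range M, T j ≤ ∑ j ∈ range (N + 1), T j :=
          sum_le_sum_of_subset_of_nonneg (range_mono hM) fun _ _ _ => hT0 _
      _ ≤ mult c * ∑ m ∈ range (N + 1), f m ^ 2 :=
          Q.sum_sum_near_le _ (fun m => f m ^ 2) fun _ => sq_nonneg _
      _ ≤ _ := by gcongr
  calc ∑ j ∈ range M, P j ^ 2
      ≤ ∑ j ∈ range M, (3 * g j ^ 2 + 27 * g₁ j ^ 2 + 48 * T j) :=
        sum_le_sum fun j hj => hsq j (mem_range.mp hj)
    _ = 3 * ∑ j ∈ range M, g j ^ 2 + 27 * ∑ j ∈ range M, g₁ j ^ 2 + 48 * ∑ j ∈ range M, T j := by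
        simp only [sum_add_distrib, ← mul_sum]
    _ ≤ 30 * ∑ e, g e ^ 2 + 48 * (mult c * ∑ e, g e ^ 2) := by linarith
    _ ≤ _ := by
        have : 0 ≤ ∑ e, g e ^ 2 := sum_nonneg fun _ _ => sq_nonneg _
        nlinarith

lemma sum_sq_foldCell_le (Q : QuasiUniform N y L H c) [NeZero (2 * N)] (g : ZMod (2 * N) → ℝ) :
    ∑ j ∈ range N, foldCell N y L j g ^ 2 ≤ 78 * mult c * ∑ e, g e ^ 2 := by
  have hN := Q.one_le
  refine Q.sum_sq_fold_le (Nat.le_succ N) g (fun e => g (-1 - e)) _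
    (fun m => g (-1 - m))
    (sum_range_neg_one_sub_natCast_le (by omega) (fun e => g e ^ 2) fun _ => sq_nonneg _)
    (Equiv.sum_comp (Equiv.subLeft (-1 : ZMod (2 * N))) fun e => g e ^ 2) fun j hj => ?_
  set T := √(∑ m ∈ (range (N + 1)).filter (fun m => |y m - bend L (y j)| ≤ 3 * H),
    g (-1 - m) ^ 2) with hT
  have h := Q.abs_sum_overlap_sub_le hj (Or.inl rfl) (fun m => g (-1 - m)) 0 T ?_
  · have hs := bendSlope_le Q.L_pos (Q.nonneg hj.le) (Q.le_last hj.le) (Q.nonneg hj)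
      (Q.le_last hj)
    have hT0 : 0 ≤ T := Real.sqrt_nonneg _
    rw [foldCell_apply]
    rw [mul_zero, sub_zero] at h
    generalize 1 / (y (j + 1) - y j) * ∑ m ∈ range N, overlap L y j m * g (-1 - m) = B at *
    have hB : |B| ≤ 2 * T := h.trans (mul_le_mul_of_nonneg_right hs hT0)
    rw [abs_le] at hB ⊢
    have a1 := neg_abs_le (g j)
    have a2 := le_abs_self (g j)
    have a3 := neg_abs_le (g (-1 - j))
    have a4 := le_abs_self (g (-1 - j))
    constructor <;> linarith
  · intro m hm hnear
    rw [sub_zero]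
    exact abs_le_sqrt_sum_sq (f := fun m => g (-1 - m))
      (mem_filter.mpr ⟨mem_range.mpr (by omega), hnear⟩)

lemma sum_sq_foldNode_le (Q : QuasiUniform N y L H c) [NeZero (2 * N)] (u : ZMod (2 * N) → ℝ) :
    ∑ j ∈ range (N + 1), foldNode N y L j u ^ 2 ≤ 78 * mult c * ∑ e, u e ^ 2 := by
  have hN := Q.one_le
  refine Q.sum_sq_fold_le le_rfl u (fun e => u (-e)) _ (fun m => u (-m))
    (sum_range_neg_natCast_le (by omega) (fun e => u e ^ 2) fun _ => sq_nonneg _)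
    (Equiv.sum_comp (Equiv.neg (ZMod (2 * N))) fun e => u e ^ 2) fun j hj => ?_
  set T := √(∑ m ∈ (range (N + 1)).filter (fun m => |y m - bend L (y j)| ≤ 3 * H),
    u (-m) ^ 2) with hT
  have hb := Q.bend_mem (j := j) (by omega)
  have h := Q.abs_interpolate_le hb.1 hb.2 (fun m => u (-m)) T ?_
  · have hT0 : 0 ≤ T := Real.sqrt_nonneg _
    rw [foldNode_apply]
    simp only [Nat.cast_zero, neg_zero, Nat.cast_succ] at h
    generalize u 0 + ∑ m ∈ range N, covered y (bend L (y j)) m / (y (m + 1) - y m) *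
      (u (-(m + 1)) - u (-m)) = B at *
    rw [abs_le] at h ⊢
    have a1 := neg_abs_le (u j)
    have a2 := le_abs_self (u j)
    have a3 := neg_abs_le (u (-j))
    have a4 := le_abs_self (u (-j))
    constructor <;> linarith
  · intro m hm hnear
    exact abs_le_sqrt_sum_sq (f := fun m => u (-m))
      (mem_filter.mpr ⟨mem_range.mpr (by omega), hnear⟩)

/-- The oscillation of `f` over the cells near a point is at most the total variation there. -/
lemma abs_sub_le_sum_near (Q : QuasiUniform N y L H c)
    (f : ℕ → ℝ) (t : ℝ) {m m' : ℕ} (hm : m < N) (hm' : m' < N)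
    (h : |y m - t| ≤ 3 * H) (h' : |y m' - t| ≤ 3 * H) :
    |f m - f m'| ≤
      ∑ l ∈ (Ico 1 N).filter (fun l => |y l - t| ≤ 3 * H), |f l - f (l - 1)| := by
  wlog hle : m' ≤ m generalizing m m'
  · rw [abs_sub_comm]
    exact this hm' hm h' h (by omega)
  have key : ∀ k, m' ≤ k → |f k - f m'| ≤ ∑ l ∈ Ioc m' k, |f l - f (l - 1)| := by
    intro k hk
    induction k, hk using Nat.le_induction with
    | base => simp
    | succ k hk ih =>
      rw [← Finset.insert_Ioc_right_eq_Ioc_add_one hk, sum_insert (by simp), Nat.add_sub_cancel]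
      have := abs_add_le (f (k + 1) - f k) (f k - f m')
      rw [sub_add_sub_cancel] at this
      linarith
  refine (key m hle).trans (sum_le_sum_of_subset_of_nonneg ?_ fun _ _ _ => abs_nonneg _)
  intro l hl
  rw [mem_Ioc] at hl
  have h1 := Q.mono hl.2 hm.le
  have h2 := Q.mono hl.1.le (by omega)
  rw [abs_le] at h h'
  refine mem_filter.mpr ⟨mem_Ico.mpr ⟨by omega, by omega⟩, ?_⟩
  rw [abs_le]
  constructor <;> linarith

lemma abs_foldJump_le (Q : QuasiUniform N y L H c) (g : ZMod (2 * N) → ℝ) {j : ℕ} (hj : j ≤ N) :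
    |foldJump N y L j g| ≤ |g j - g (j - 1)| + 3 * |g (-j) - g (-j - 1)| +
      4 * (∑ l ∈ (Ico 1 N).filter (fun l => |y l - bend L (y j)| ≤ 3 * H),
        |g (-l) - g (-l - 1)|) +
      12 * (H / L) *
        √(∑ m ∈ (range N).filter (fun m => |y m - bend L (y j)| ≤ 3 * H), g (-1 - m) ^ 2) := by
  have hN := Q.one_le
  have hL := Q.L_pos
  have hH := Q.H_pos
  set f : ℕ → ℝ := fun m => g (-1 - m) with hf
  set T := √(∑ m ∈ (range N).filter (fun m => |y m - bend L (y j)| ≤ 3 * H), g (-1 - m) ^ 2)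
    with hT
  set S := ∑ l ∈ (Ico 1 N).filter (fun l => |y l - bend L (y j)| ≤ 3 * H),
    |g (-l) - g (-l - 1)| with hS
  have hS0 : 0 ≤ S := sum_nonneg fun _ _ => abs_nonneg _
  have hT0 : 0 ≤ T := Real.sqrt_nonneg _
  have hHL : 0 < H / L := div_pos hH hL
  have hosc : ∀ m < N, |y m - bend L (y j)| ≤ 3 * H → ∀ m' < N,
      |y m' - bend L (y j)| ≤ 3 * H → |f m - f m'| ≤ S := by
    intro m hm h m' hm' h'
    refine (Q.abs_sub_le_sum_near f _ hm hm' h h').trans_eq ?_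
    refine sum_congr rfl fun l hl => ?_
    have hl := (mem_Ico.mp (mem_filter.mp hl).1).1
    obtain ⟨l, rfl⟩ : ∃ i, l = i + 1 := ⟨l - 1, by omega⟩
    rw [abs_sub_comm]
    simp only [hf, Nat.add_sub_cancel]
    push_cast
    congr 3 <;> ring_nf
  have hval : ∀ m < N, |y m - bend L (y j)| ≤ 3 * H → |f m| ≤ T := by
    intro m hm h
    exact abs_le_sqrt_sum_sq (f := f) (mem_filter.mpr ⟨mem_range.mpr hm, h⟩)
  have hslope : ∀ i < N, 0 < bendSlope L (y i) (y (i + 1)) ∧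
      bendSlope L (y i) (y (i + 1)) ≤ 2 := fun i hi =>
    ⟨lt_of_lt_of_le (by norm_num) (half_le_bendSlope hL _ _),
      bendSlope_le hL (Q.nonneg hi.le) (Q.le_last hi.le) (Q.nonneg hi) (Q.le_last hi)⟩
  -- at an end of the interval the folded value is compared with the value `f i` at the end cell
  have hend : ∀ i < N, (j = i ∨ j = i + 1) → |y i - bend L (y j)| ≤ 3 * H →
      |bendSlope L (y i) (y (i + 1)) - 2| ≤ 3 * (H / L) →
      |1 / (y (i + 1) - y i) * (∑ m ∈ range N, overlap L y i m * f m) - 2 * f i| ≤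
        2 * S + 3 * (H / L) * T := by
    intro i hi hij hnear hsl
    have h1 := Q.abs_sum_overlap_sub_le hi hij f (f i) S fun m hm h => hosc m hm h i hi hnear
    have h2 := hval i hi hnear
    have h3 := (hslope i hi).2
    generalize 1 / (y (i + 1) - y i) * (∑ m ∈ range N, overlap L y i m * f m) = B at *
    generalize bendSlope L (y i) (y (i + 1)) = σ at *
    calc |B - 2 * f i| = |(B - σ * f i) + (σ - 2) * f i| := by ring_nf
      _ ≤ |B - σ * f i| + |σ - 2| * |f i| := by
          rw [← abs_mul]; exact abs_add_le _ _
      _ ≤ 2 * S + 3 * (H / L) * T := by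
          refine add_le_add (h1.trans ?_) ?_
          · gcongr
          · gcongr
  rcases Nat.eq_zero_or_pos j with rfl | hjpos
  · have hB := hend 0 hN (Or.inl rfl) (by rw [Q.bend_zero, Q.zero]; simp; positivity) (by
      rw [Q.zero]
      have := Q.upper 0 hN
      rw [Q.zero, sub_zero] at this
      exact abs_bendSlope_zero_sub_le hL (Q.nonneg hN) (Q.le_last hN) this)
    have e : foldJump N y L 0 g = foldCell N y L 0 g := by
      simp [foldJump, show 0 < N from hN]
    rw [e, foldCell_apply]
    simp only [hf] at hB
    generalize 1 / (y (0 + 1) - y 0) * (∑ m ∈ range N, overlap L y 0 m * g (-1 - m)) = B at *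
    simp only [Nat.cast_zero, sub_zero, zero_sub, neg_zero] at *
    rw [abs_le] at hB ⊢
    have a1 := neg_abs_le (g 0 - g (-1))
    have a2 := le_abs_self (g 0 - g (-1))
    have a3 : 0 ≤ H / L * T := by positivity
    constructor <;> linarith
  obtain ⟨i, rfl⟩ : ∃ i, j = i + 1 := ⟨j - 1, by omega⟩
  have hi : i < N := by omega
  have hcast : ((i + 1 : ℕ) : ZMod (2 * N)) - 1 = i := by push_cast; ring
  rcases hj.lt_or_eq with hlt | heq
  · -- interior node
    have e : foldJump N y L (i + 1) g = foldCell N y L (i + 1) g - foldCell N y L i g := by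
      simp [foldJump, hlt]
    have hσ := hslope i hi
    have hσ' := hslope (i + 1) hlt
    have hdσ := abs_bendSlope_sub_le hL (Q.nonneg hi.le) (Q.le_last hlt)
      (Q.mono (Nat.le_succ i) hi) (Q.mono (Nat.le_succ (i + 1)) hlt) (Q.upper i hi)
      (Q.upper (i + 1) hlt)
    have hA0 := Q.abs_sum_overlap_sub_le hi (Or.inr rfl) f 0 T
      fun m hm h => by rw [sub_zero]; exact hval m hm h
    have hA1 : ∀ m < N, |y m - bend L (y (i + 1))| ≤ 3 * H → _ := fun m hm h =>
      Q.abs_sum_overlap_sub_le hi (Or.inr rfl) f (f m) S fun m' hm' h' => hosc m' hm' h' m hm h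
    set B := 1 / (y (i + 1) - y i) * (∑ m ∈ range N, overlap L y i m * f m) with hB
    set σ := bendSlope L (y i) (y (i + 1)) with hσdef
    have hAB : B = σ * (B / σ) := by field_simp [hσ.1.ne']
    have hA2 : |B / σ| ≤ T := by
      rw [mul_zero, sub_zero] at hA0
      rw [abs_div, abs_of_pos hσ.1, div_le_iff₀ hσ.1]
      linarith
    have hA3 : ∀ m < N, |y m - bend L (y (i + 1))| ≤ 3 * H → |f m - B / σ| ≤ S := by
      intro m hm h
      have := hA1 m hm h
      rw [hAB, ← mul_sub, abs_mul, abs_of_pos hσ.1] at this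
      rw [abs_sub_comm]
      exact le_of_mul_le_mul_left this hσ.1
    have hB' := Q.abs_sum_overlap_sub_le hlt (Or.inl rfl) f (B / σ) S hA3
    rw [e, foldCell_apply, foldCell_apply]
    change |g ↑(i + 1) + 3 * f (i + 1) - 2 * (1 / (y (i + 1 + 1) - y (i + 1)) *
      ∑ m ∈ range N, overlap L y (i + 1) m * f m) - (g i + 3 * f i - 2 * B)| ≤ _
    generalize 1 / (y (i + 1 + 1) - y (i + 1)) *
      (∑ m ∈ range N, overlap L y (i + 1) m * f m) = B' at *
    generalize bendSlope L (y (i + 1)) (y (i + 1 + 1)) = σ' at *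
    have hBB : |B' - B| ≤ 2 * S + 6 * (H / L) * T := by
      calc |B' - B| = |(B' - σ' * (B / σ)) + (σ' - σ) * (B / σ)| := by
            congr 1
            linear_combination -hAB
        _ ≤ |B' - σ' * (B / σ)| + |σ' - σ| * |B / σ| := by
            rw [← abs_mul]; exact abs_add_le _ _
        _ ≤ 2 * S + 6 * (H / L) * T := by
            refine add_le_add (hB'.trans ?_) ?_
            · have := hσ'.2
              gcongr
            · gcongr
    rw [hcast]
    have c1 : g (-((i + 1 : ℕ) : ZMod (2 * N))) = f i := by
      simp only [hf]; push_cast; congr 1; ring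
    have c2 : g (-((i + 1 : ℕ) : ZMod (2 * N)) - 1) = f (i + 1) := by
      simp only [hf]; push_cast; congr 1; ring
    rw [c1, c2]
    rw [abs_le] at hBB ⊢
    have a1 := neg_abs_le (g ((i + 1 : ℕ) : ZMod (2 * N)) - g i)
    have a2 := le_abs_self (g ((i + 1 : ℕ) : ZMod (2 * N)) - g i)
    have a3 := neg_abs_le (f i - f (i + 1))
    have a4 := le_abs_self (f i - f (i + 1))
    constructor <;> linarith
  · have hup := Q.upper i hi
    rw [heq, Q.last] at hup
    have hlast := Q.bend_last
    have hyi := Q.le_last hi.le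
    have hB := hend i hi (Or.inr rfl)
      (by rw [heq, hlast, abs_le]; constructor <;> linarith) (by
        rw [heq, Q.last]
        exact abs_bendSlope_last_sub_le hL (Q.nonneg hi.le) hyi hup)
    have e : foldJump N y L (i + 1) g = -foldCell N y L i g := by
      simp [foldJump, show ¬ i + 1 < N by omega]
    rw [e, foldCell_apply]
    change |-(g i + 3 * f i - 2 * (1 / (y (i + 1) - y i) *
      ∑ m ∈ range N, overlap L y i m * f m))| ≤ _
    generalize 1 / (y (i + 1) - y i) * (∑ m ∈ range N, overlap L y i m * f m) = B at *
    have c1 : g ((i + 1 : ℕ) : ZMod (2 * N)) = f i := by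
      have h : ((i + 1 : ℕ) : ZMod (2 * N)) = (N : ZMod (2 * N)) := congrArg _ heq
      have h' : ((i + 1 : ℕ) : ZMod (2 * N)) = -1 - i := by
        rw [h, ← neg_natCast_self_two_mul, ← h]
        push_cast
        ring
      rw [h']
    rw [hcast, c1]
    rw [abs_le] at hB ⊢
    have a1 := neg_abs_le (f i - g i)
    have a2 := le_abs_self (f i - g i)
    have a3 : 0 ≤ H / L * T := by positivity
    have a4 := abs_nonneg
      (g (-((i + 1 : ℕ) : ZMod (2 * N))) - g (-((i + 1 : ℕ) : ZMod (2 * N)) - 1))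
    constructor <;> linarith

lemma sum_sq_foldJump_le (Q : QuasiUniform N y L H c) [NeZero (2 * N)] (g : ZMod (2 * N) → ℝ) :
    ∑ j ∈ range (N + 1), foldJump N y L j g ^ 2 ≤
      576 * mult c ^ 2 * (∑ e, (g e - g (e - 1)) ^ 2 + (H / L) ^ 2 * ∑ e, g e ^ 2) := by
  have hN := Q.one_le
  have hK := Q.one_le_mult
  set K := mult c with hKdef
  set D : ZMod (2 * N) → ℝ := fun e => g e - g (e - 1) with hD
  set E := ∑ e, D e ^ 2 with hE
  set F := ∑ e, g e ^ 2 with hF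
  set V : ℕ → ℝ := fun j =>
    ∑ l ∈ (Ico 1 N).filter (fun l => |y l - bend L (y j)| ≤ 3 * H), D (-l) ^ 2 with hV
  set T : ℕ → ℝ := fun j =>
    ∑ m ∈ (range N).filter (fun m => |y m - bend L (y j)| ≤ 3 * H), g (-1 - m) ^ 2 with hT
  have hT0 : ∀ j, 0 ≤ T j := fun j => sum_nonneg fun _ _ => sq_nonneg _
  have hsq : ∀ j ∈ range (N + 1), foldJump N y L j g ^ 2 ≤
      4 * D j ^ 2 + 36 * D (-j) ^ 2 + 64 * K * V j + 576 * (H / L) ^ 2 * T j := by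
    intro j hj
    have h := Q.abs_foldJump_le g (j := j) (by have := mem_range.mp hj; omega)
    set S := ∑ l ∈ (Ico 1 N).filter (fun l => |y l - bend L (y j)| ≤ 3 * H),
      |g (-l) - g (-l - 1)| with hS
    have hSV : S ^ 2 ≤ K * V j := by
      refine (sq_sum_le_card_mul_sum_sq).trans ?_
      simp only [sq_abs]
      refine mul_le_mul_of_nonneg_right (le_trans ?_ (Q.card_node_near_le (bend L (y j))))
        (sum_nonneg fun _ _ => sq_nonneg _)
      have : (Ico 1 N).filter (fun l => |y l - bend L (y j)| ≤ 3 * H) ⊆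
          (range (N + 1)).filter (fun l => |y l - bend L (y j)| ≤ 3 * H) :=
        filter_subset_filter _ fun l hl => mem_range.mpr (by have := mem_Ico.mp hl; omega)
      exact_mod_cast card_le_card this
    have h2 : foldJump N y L j g ^ 2 ≤
        (|D j| + 3 * |D (-j)| + 4 * S + 12 * (H / L) * √(T j)) ^ 2 := by
      rw [← sq_abs (foldJump N y L j g)]; exact pow_le_pow_left₀ (abs_nonneg _) h 2
    have e1 := sq_abs (D j)
    have e2 := sq_abs (D (-j))
    have e3 := Real.sq_sqrt (hT0 j)
    have h4 : ∀ a b p q : ℝ, (a + b + p + q) ^ 2 ≤ 4 * (a ^ 2 + b ^ 2 + p ^ 2 + q ^ 2) := by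
      intro a b p q
      nlinarith [sq_nonneg (a - b), sq_nonneg (a - p), sq_nonneg (a - q), sq_nonneg (b - p),
        sq_nonneg (b - q), sq_nonneg (p - q)]
    refine (h2.trans (h4 _ _ _ _)).trans ?_
    rw [mul_pow (12 * (H / L)), e3, mul_pow 3, e1, e2]
    nlinarith
  have s1 := sum_range_natCast_le (n := 2 * N) (M := N + 1) (by omega) (fun e => D e ^ 2)
    fun _ => sq_nonneg _
  have s2 := sum_range_neg_natCast_le (n := 2 * N) (M := N + 1) (by omega) (fun e => D e ^ 2)
    fun _ => sq_nonneg _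
  have s3 : ∑ j ∈ range (N + 1), V j ≤ K * E := by
    refine (Q.sum_sum_near_le _ (fun l => D (-l) ^ 2) fun _ => sq_nonneg _).trans ?_
    refine mul_le_mul_of_nonneg_left (le_trans ?_ s2) (by linarith)
    exact sum_le_sum_of_subset_of_nonneg
      (fun l hl => mem_range.mpr (by have := mem_Ico.mp hl; omega)) fun _ _ _ => sq_nonneg _
  have s4 : ∑ j ∈ range (N + 1), T j ≤ K * F := by
    refine (Q.sum_sum_near_le _ (fun m => g (-1 - m) ^ 2) fun _ => sq_nonneg _).trans ?_
    exact mul_le_mul_of_nonneg_left (sum_range_neg_one_sub_natCast_le (by omega)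
      (fun e => g e ^ 2) fun _ => sq_nonneg _) (by linarith)
  have hE0 : 0 ≤ E := sum_nonneg fun _ _ => sq_nonneg _
  have hF0 : 0 ≤ F := sum_nonneg fun _ _ => sq_nonneg _
  have hK2 : K ≤ K ^ 2 := by nlinarith
  calc ∑ j ∈ range (N + 1), foldJump N y L j g ^ 2
      ≤ ∑ j ∈ range (N + 1),
        (4 * D j ^ 2 + 36 * D (-j) ^ 2 + 64 * K * V j + 576 * (H / L) ^ 2 * T j) :=
        sum_le_sum hsq
    _ = 4 * ∑ j ∈ range (N + 1), D j ^ 2 + 36 * ∑ j ∈ range (N + 1), D (-j) ^ 2 +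
        64 * K * ∑ j ∈ range (N + 1), V j + 576 * (H / L) ^ 2 * ∑ j ∈ range (N + 1), T j := by
        simp only [sum_add_distrib, ← mul_sum]
    _ ≤ 4 * E + 36 * E + 64 * K * (K * E) + 576 * (H / L) ^ 2 * (K * F) := by gcongr
    _ = (40 + 64 * K ^ 2) * E + 576 * K * ((H / L) ^ 2 * F) := by ring
    _ ≤ (576 * K ^ 2) * E + 576 * K ^ 2 * ((H / L) ^ 2 * F) := by
        gcongr
        nlinarith
    _ = _ := by ring

end QuasiUniform

end RMAC

namespace RMAC

/-! ### Fields on the double of a rectangle -/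

/-- The cell of a partition with `N` cells over which a cell of its double lies. -/
def cellIndex (N : ℕ) (c : ZMod (2 * N)) : ℕ := if c.val < N then c.val else 2 * N - 1 - c.val

/-- The step sizes of the double of a partition. -/
def doubleStep (N : ℕ) (y : ℕ → ℝ) (c : ZMod (2 * N)) : ℝ :=
  y (cellIndex N c + 1) - y (cellIndex N c)

/-- Extension by zero of a cell function to the double of a rectangle. -/
def extendZero (N₁ N₂ : ℕ) (q : ℕ → ℕ → ℝ) (c : ZMod (2 * N₁)) (e : ZMod (2 * N₂)) : ℝ :=
  if c.val < N₁ ∧ e.val < N₂ then q c.val e.val else 0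

lemma cellIndex_lt {N : ℕ} [NeZero (2 * N)] (c : ZMod (2 * N)) : cellIndex N c < N := by
  have := ZMod.val_lt c
  unfold cellIndex
  split_ifs <;> omega

lemma val_natCast_of_lt_half {N j : ℕ} (hj : j < N) : (j : ZMod (2 * N)).val = j :=
  ZMod.val_natCast_of_lt (by omega)

lemma val_neg_one_sub_natCast {N j : ℕ} (hj : j < N) :
    (-1 - j : ZMod (2 * N)).val = 2 * N - 1 - j := by
  have h : (-1 - j : ZMod (2 * N)) = ((2 * N - 1 - j : ℕ) : ZMod (2 * N)) := by
    rw [Nat.sub_sub, Nat.cast_sub (by omega), ZMod.natCast_self]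
    push_cast
    ring
  rw [h, ZMod.val_natCast_of_lt (by omega)]

lemma doubleStep_natCast {N : ℕ} (y : ℕ → ℝ) {j : ℕ} (hj : j < N) :
    doubleStep N y j = y (j + 1) - y j := by
  simp [doubleStep, cellIndex, val_natCast_of_lt_half hj, hj]

lemma doubleStep_neg_one_sub {N : ℕ} (y : ℕ → ℝ) {j : ℕ} (hj : j < N) :
    doubleStep N y (-1 - j) = y (j + 1) - y j := by
  have : cellIndex N (-1 - j) = j := by
    rw [cellIndex, val_neg_one_sub_natCast hj, if_neg (by omega)]
    omega
  rw [doubleStep, this]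

lemma sum_zmod_eq_sum_range {n : ℕ} [NeZero n] (F : ℕ → ℝ) :
    ∑ c : ZMod n, F c.val = ∑ j ∈ range n, F j := by
  refine sum_bij (fun c _ => c.val) (fun c _ => mem_range.mpr (ZMod.val_lt c))
    (fun a _ b _ h => ZMod.val_injective n h)
    (fun j hj => ⟨j, mem_univ _, ZMod.val_natCast_of_lt (mem_range.mp hj)⟩) fun _ _ => rfl

lemma sum_double_eq_sum_range {N : ℕ} [NeZero (2 * N)] (F : ZMod (2 * N) → ℝ)
    (hF : ∀ c, ¬ c.val < N → F c = 0) : ∑ c, F c = ∑ j ∈ range N, F j := by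
  have e : ∀ c : ZMod (2 * N), F c = F (c.val : ℕ) := fun c => by rw [ZMod.natCast_zmod_val]
  rw [sum_congr rfl fun c _ => e c, sum_zmod_eq_sum_range (fun j => F j)]
  refine (sum_subset (range_mono (by omega)) fun j hj hj' => hF _ ?_).symm
  rwa [ZMod.val_natCast_of_lt (mem_range.mp hj), ← mem_range]

/-- A bound for functionals in one variable bounds their composition with others. -/
lemma sum_sum_sq_comp_le {ι : Type*} [Fintype ι] {s t : Finset ℕ} {A : ℕ → (ι → ℝ) → ℝ} {a : ℝ}
    (hA : ∀ g, ∑ i ∈ s, A i g ^ 2 ≤ a * ∑ m, g m ^ 2) (F : ℕ → ι → ℝ) :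
    ∑ i ∈ s, ∑ j ∈ t, A i (F j) ^ 2 ≤ a * ∑ m, ∑ j ∈ t, F j m ^ 2 := by
  rw [sum_comm, sum_comm (s := univ), mul_sum]
  exact sum_le_sum fun j _ => hA _

lemma sum_sum_extendZero {N₁ N₂ : ℕ} [NeZero (2 * N₁)] [NeZero (2 * N₂)] (x y : ℕ → ℝ)
    (q : ℕ → ℕ → ℝ) {φ : ℝ → ℝ} (hφ : φ 0 = 0) :
    ∑ c, ∑ e, doubleStep N₁ x c * doubleStep N₂ y e * φ (extendZero N₁ N₂ q c e) =
      ∑ i ∈ range N₁, ∑ j ∈ range N₂, (x (i + 1) - x i) * (y (j + 1) - y j) * φ (q i j) := by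
  rw [sum_double_eq_sum_range]
  · refine sum_congr rfl fun i hi => ?_
    rw [sum_double_eq_sum_range]
    · refine sum_congr rfl fun j hj => ?_
      rw [mem_range] at hi hj
      simp only [extendZero, doubleStep_natCast _ hi, doubleStep_natCast _ hj,
        val_natCast_of_lt_half hi, val_natCast_of_lt_half hj, hi, hj, and_self, if_true]
    · intro e he
      simp [extendZero, he, hφ]
  · intro c hc
    simp [extendZero, hc, hφ]

lemma foldCell_extendZero {N₁ N₂ : ℕ} (x y : ℕ → ℝ) (L₁ L₂ : ℝ) (q : ℕ → ℕ → ℝ) {i j : ℕ}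
    (hi : i < N₁) (hj : j < N₂) :
    foldCell N₁ x L₁ i (fun c => foldCell N₂ y L₂ j (extendZero N₁ N₂ q c)) = q i j := by
  have key : ∀ (N : ℕ) (y : ℕ → ℝ) (L : ℝ) (j : ℕ) (_ : j < N) (g : ZMod (2 * N) → ℝ),
      (∀ m < N, g (-1 - m) = 0) → foldCell N y L j g = g j := by
    intro N y L j hj g hg
    rw [foldCell_apply, hg j hj, sum_eq_zero fun m hm => by rw [hg m (mem_range.mp hm), mul_zero]]
    ring
  have hzero : ∀ c : ZMod (2 * N₁), ∀ m < N₂, extendZero N₁ N₂ q c (-1 - m) = 0 := by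
    intro c m hm
    rw [extendZero, val_neg_one_sub_natCast hm, if_neg (by omega)]
  have h2 : (fun c => foldCell N₂ y L₂ j (extendZero N₁ N₂ q c)) =
      fun c => extendZero N₁ N₂ q c j := funext fun c => key _ _ _ _ hj _ (hzero c)
  rw [h2, key _ _ _ _ hi]
  · simp [extendZero, val_natCast_of_lt_half hi, val_natCast_of_lt_half hj, hi, hj]
  · intro m hm
    rw [extendZero, val_neg_one_sub_natCast hm, if_neg (by omega)]

/-- Folding of a field on the double that lives on nodes in the first direction and on cells in
the second. -/
def foldField (N₁ : ℕ) (x : ℕ → ℝ) (L₁ : ℝ) (N₂ : ℕ) (y : ℕ → ℝ) (L₂ : ℝ)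
    (u : ZMod (2 * N₁) → ZMod (2 * N₂) → ℝ) (i j : ℕ) : ℝ :=
  foldNode N₁ x L₁ i fun m => foldCell N₂ y L₂ j (u m)

/-- The constant in the bounds for folded fields. -/
def foldConst (c L₁ L₂ : ℝ) : ℝ :=
  44928 * mult c ^ 3 * (1 + 1 / c ^ 2 + 4 * L₁ ^ 2 / c ^ 3 + 4 * L₁ ^ 2 / (c ^ 3 * L₂ ^ 2))

lemma foldConst_pos {c : ℝ} (hc : 0 < c) (L₁ L₂ : ℝ) : 0 < foldConst c L₁ L₂ := by
  unfold foldConst mult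
  positivity

namespace QuasiUniform

variable {N N₁ N₂ : ℕ} {x y : ℕ → ℝ} {L L₁ L₂ H H₁ H₂ c : ℝ}

lemma neZero_two_mul (Q : QuasiUniform N y L H c) : NeZero (2 * N) :=
  ⟨by have := Q.one_le; omega⟩

lemma natCast_mul_le (Q : QuasiUniform N y L H c) : N * (c * H) ≤ L := by
  have h : ∑ j ∈ range N, (y (j + 1) - y j) = L := by
    rw [sum_range_sub, Q.last, Q.zero, sub_zero]
  rw [← h]
  calc (N : ℝ) * (c * H) = ∑ _j ∈ range N, c * H := by simp
    _ ≤ _ := sum_le_sum fun j hj => Q.lower j (mem_range.mp hj)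

lemma le_doubleStep [NeZero (2 * N)] (Q : QuasiUniform N y L H c) (e : ZMod (2 * N)) :
    c * H ≤ doubleStep N y e := Q.lower _ (cellIndex_lt e)

lemma doubleStep_le [NeZero (2 * N)] (Q : QuasiUniform N y L H c) (e : ZMod (2 * N)) :
    doubleStep N y e ≤ H := Q.upper _ (cellIndex_lt e)

lemma doubleStep_pos [NeZero (2 * N)] (Q : QuasiUniform N y L H c) (e : ZMod (2 * N)) :
    0 < doubleStep N y e := Q.step_pos (cellIndex_lt e)

/-- A Poincaré inequality on the double. -/
lemma mul_sum_sq_le [NeZero (2 * N)] (Q : QuasiUniform N y L H c) (u : ZMod (2 * N) → ℝ)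
    (hu : ∑ e, u e = 0) :
    H * ∑ e, u e ^ 2 ≤ 4 * L ^ 2 / c ^ 2 *
      ∑ e, doubleStep N y e * ((u (e + 1) - u e) / doubleStep N y e) ^ 2 := by
  have hc := Q.c_pos
  have hH := Q.H_pos
  have hL := Q.L_pos
  have h := sum_sq_le_of_sum_eq_zero (doubleStep N y) u Q.doubleStep_pos hu
  have hNL : (N : ℝ) * H ≤ L / c := by
    rw [le_div_iff₀ hc]
    have := Q.natCast_mul_le
    linarith
  have hs : ∑ e, doubleStep N y e ≤ 2 * (L / c) := by
    calc ∑ e, doubleStep N y e ≤ ∑ _e : ZMod (2 * N), H := sum_le_sum fun e _ => Q.doubleStep_le e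
      _ = 2 * (N * H) := by
        rw [sum_const, card_univ, ZMod.card, nsmul_eq_mul]; push_cast; ring
      _ ≤ _ := by gcongr
  have hs0 : 0 ≤ ∑ e, doubleStep N y e := sum_nonneg fun e _ => (Q.doubleStep_pos e).le
  have hS : 0 ≤ ∑ e, doubleStep N y e * ((u (e + 1) - u e) / doubleStep N y e) ^ 2 :=
    sum_nonneg fun e _ => mul_nonneg (Q.doubleStep_pos e).le (sq_nonneg _)
  generalize ∑ e, doubleStep N y e * ((u (e + 1) - u e) / doubleStep N y e) ^ 2 = S at *
  generalize ∑ e, doubleStep N y e = W at *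
  push_cast at h
  calc H * ∑ e, u e ^ 2 ≤ H * (2 * N * W * S) := by gcongr
    _ = 2 * (N * H) * W * S := by ring
    _ ≤ 2 * (L / c) * (2 * (L / c)) * S := by gcongr
    _ = _ := by ring

lemma foldField_zero (Q₁ : QuasiUniform N₁ x L₁ H₁ c) (u : ZMod (2 * N₁) → ZMod (2 * N₂) → ℝ)
    (j : ℕ) : foldField N₁ x L₁ N₂ y L₂ u 0 j = 0 := Q₁.foldNode_zero _

lemma foldField_last (Q₁ : QuasiUniform N₁ x L₁ H₁ c) (u : ZMod (2 * N₁) → ZMod (2 * N₂) → ℝ)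
    (j : ℕ) : foldField N₁ x L₁ N₂ y L₂ u N₁ j = 0 := Q₁.foldNode_last _

lemma foldField_succ_sub_div (Q₁ : QuasiUniform N₁ x L₁ H₁ c)
    (u : ZMod (2 * N₁) → ZMod (2 * N₂) → ℝ) {i : ℕ} (hi : i < N₁) (j : ℕ) :
    (foldField N₁ x L₁ N₂ y L₂ u (i + 1) j - foldField N₁ x L₁ N₂ y L₂ u i j) /
      (x (i + 1) - x i) = foldCell N₁ x L₁ i fun m => foldCell N₂ y L₂ j fun e =>
        (u (m + 1) e - u m e) / doubleStep N₁ x m := by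
  rw [foldField, foldField, Q₁.foldNode_succ_sub (fun j => doubleStep_natCast x)
    (fun j => doubleStep_neg_one_sub x) _ hi, mul_div_cancel_left₀ _ (Q₁.step_pos hi).ne']
  congr 1
  funext m
  rw [← map_sub, div_eq_inv_mul, ← smul_eq_mul, ← map_smul]
  congr 1
  funext e
  simp [div_eq_inv_mul]

lemma foldField_jump (u : ZMod (2 * N₁) → ZMod (2 * N₂) → ℝ) (i j : ℕ) :
    (if j < N₂ then foldField N₁ x L₁ N₂ y L₂ u i j else 0) -
      (if j = 0 then 0 else foldField N₁ x L₁ N₂ y L₂ u i (j - 1)) =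
      foldNode N₁ x L₁ i fun m => foldJump N₂ y L₂ j (u m) := by
  have e : (fun m => foldJump N₂ y L₂ j (u m)) =
      (fun m => if j < N₂ then foldCell N₂ y L₂ j (u m) else 0) -
        fun m => if j = 0 then 0 else foldCell N₂ y L₂ (j - 1) (u m) := by
    funext m
    simp only [foldJump, Pi.sub_apply, LinearMap.sub_apply]
    split_ifs <;> simp
  rw [e, map_sub]
  unfold foldField
  congr 1
  · split_ifs
    · rfl
    · exact (map_zero (foldNode N₁ x L₁ i)).symm
  · split_ifs
    · exact (map_zero (foldNode N₁ x L₁ i)).symm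
    · rfl

section Bounds

variable [NeZero (2 * N₁)] [NeZero (2 * N₂)] {u : ZMod (2 * N₁) → ZMod (2 * N₂) → ℝ} {E : ℝ}

lemma energy_nonneg (Q₁ : QuasiUniform N₁ x L₁ H₁ c) (Q₂ : QuasiUniform N₂ y L₂ H₂ c)
    (hgrad : ∑ m, ∑ e, doubleStep N₁ x m * doubleStep N₂ y e *
      ((u (m + 1) e - u m e) / doubleStep N₁ x m) ^ 2 ≤ E) : 0 ≤ E :=
  (sum_nonneg fun m _ => sum_nonneg fun e _ => mul_nonneg
    (mul_nonneg (Q₁.doubleStep_pos m).le (Q₂.doubleStep_pos e).le) (sq_nonneg _)).trans hgrad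

lemma mul_mul_sum_sq_le (Q₁ : QuasiUniform N₁ x L₁ H₁ c) (Q₂ : QuasiUniform N₂ y L₂ H₂ c)
    (hgrad : ∑ m, ∑ e, doubleStep N₁ x m * doubleStep N₂ y e *
      ((u (m + 1) e - u m e) / doubleStep N₁ x m) ^ 2 ≤ E)
    (hmean : ∀ e, ∑ m, u m e = 0) :
    H₁ * H₂ * ∑ m, ∑ e, u m e ^ 2 ≤ 4 * L₁ ^ 2 / c ^ 3 * E := by
  have hc := Q₁.c_pos
  have h1 : ∀ e, H₁ * H₂ * ∑ m, u m e ^ 2 ≤ 4 * L₁ ^ 2 / c ^ 3 *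
      ∑ m, doubleStep N₁ x m * doubleStep N₂ y e *
        ((u (m + 1) e - u m e) / doubleStep N₁ x m) ^ 2 := by
    intro e
    have h := Q₁.mul_sum_sq_le (fun m => u m e) (hmean e)
    have hS : 0 ≤ ∑ m, doubleStep N₁ x m * ((u (m + 1) e - u m e) / doubleStep N₁ x m) ^ 2 :=
      sum_nonneg fun e _ => mul_nonneg (Q₁.doubleStep_pos e).le (sq_nonneg _)
    have e1 : ∑ m, doubleStep N₁ x m * doubleStep N₂ y e *
        ((u (m + 1) e - u m e) / doubleStep N₁ x m) ^ 2 = doubleStep N₂ y e *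
        ∑ m, doubleStep N₁ x m * ((u (m + 1) e - u m e) / doubleStep N₁ x m) ^ 2 := by
      rw [mul_sum]
      exact sum_congr rfl fun _ _ => by ring
    rw [e1]
    have hb := Q₂.le_doubleStep e
    have hH := Q₂.H_pos
    generalize ∑ m, doubleStep N₁ x m * ((u (m + 1) e - u m e) / doubleStep N₁ x m) ^ 2 = S at *
    calc H₁ * H₂ * ∑ m, u m e ^ 2 = H₂ * (H₁ * ∑ m, u m e ^ 2) := by ring
      _ ≤ H₂ * (4 * L₁ ^ 2 / c ^ 2 * S) := by gcongr
      _ = 4 * L₁ ^ 2 / c ^ 3 * ((c * H₂) * S) := by field_simp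
      _ ≤ _ := by gcongr
  rw [sum_comm] at hgrad ⊢
  calc H₁ * H₂ * ∑ e, ∑ m, u m e ^ 2 = ∑ e, H₁ * H₂ * ∑ m, u m e ^ 2 := by rw [mul_sum]
    _ ≤ ∑ e, 4 * L₁ ^ 2 / c ^ 3 * ∑ m, doubleStep N₁ x m * doubleStep N₂ y e *
        ((u (m + 1) e - u m e) / doubleStep N₁ x m) ^ 2 := sum_le_sum fun e _ => h1 e
    _ ≤ _ := by
      rw [← mul_sum]
      gcongr

lemma sum_sq_foldField_le (Q₁ : QuasiUniform N₁ x L₁ H₁ c) (Q₂ : QuasiUniform N₂ y L₂ H₂ c)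
    (hgrad : ∑ m, ∑ e, doubleStep N₁ x m * doubleStep N₂ y e *
      ((u (m + 1) e - u m e) / doubleStep N₁ x m) ^ 2 ≤ E)
    (hmean : ∀ e, ∑ m, u m e = 0) :
    H₁ * H₂ * ∑ i ∈ range (N₁ + 1), ∑ j ∈ range N₂, foldField N₁ x L₁ N₂ y L₂ u i j ^ 2 ≤
      foldConst c L₁ L₂ * E := by
  have hc := Q₁.c_pos
  have hH₁ := Q₁.H_pos
  have hH₂ := Q₂.H_pos
  have hK := Q₁.one_le_mult
  have hE := Q₁.energy_nonneg Q₂ hgrad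
  have h := Q₁.mul_mul_sum_sq_le Q₂ hgrad hmean
  have h1 := sum_sum_sq_comp_le (t := range N₂) Q₁.sum_sq_foldNode_le
    fun j m => foldCell N₂ y L₂ j (u m)
  have h2 : ∑ m, ∑ j ∈ range N₂, foldCell N₂ y L₂ j (u m) ^ 2 ≤
      78 * mult c * ∑ m, ∑ e, u m e ^ 2 := by
    rw [mul_sum]
    exact sum_le_sum fun m _ => Q₂.sum_sq_foldCell_le (u m)
  calc H₁ * H₂ * ∑ i ∈ range (N₁ + 1), ∑ j ∈ range N₂, foldField N₁ x L₁ N₂ y L₂ u i j ^ 2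
      ≤ H₁ * H₂ * (78 * mult c * (78 * mult c * ∑ m, ∑ e, u m e ^ 2)) := by
        gcongr
        exact h1.trans (by gcongr)
    _ = 6084 * mult c ^ 2 * (H₁ * H₂ * ∑ m, ∑ e, u m e ^ 2) := by ring
    _ ≤ 44928 * mult c ^ 3 * (4 * L₁ ^ 2 / c ^ 3 * E) := by
        gcongr
        · norm_num
        · norm_num
    _ ≤ foldConst c L₁ L₂ * E := by
        rw [foldConst, ← mul_assoc]
        gcongr
        have : 0 ≤ 1 + 1 / c ^ 2 + 4 * L₁ ^ 2 / (c ^ 3 * L₂ ^ 2) := by positivity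
        linarith

lemma sum_sq_foldField_diff_le (Q₁ : QuasiUniform N₁ x L₁ H₁ c) (Q₂ : QuasiUniform N₂ y L₂ H₂ c)
    (hgrad : ∑ m, ∑ e, doubleStep N₁ x m * doubleStep N₂ y e *
      ((u (m + 1) e - u m e) / doubleStep N₁ x m) ^ 2 ≤ E) :
    H₁ * H₂ * ∑ i ∈ range N₁, ∑ j ∈ range N₂,
      ((foldField N₁ x L₁ N₂ y L₂ u (i + 1) j - foldField N₁ x L₁ N₂ y L₂ u i j) /
        (x (i + 1) - x i)) ^ 2 ≤ foldConst c L₁ L₂ * E := by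
  have hc := Q₁.c_pos
  have hH₁ := Q₁.H_pos
  have hH₂ := Q₂.H_pos
  have hK := Q₁.one_le_mult
  have hE := Q₁.energy_nonneg Q₂ hgrad
  set a : ZMod (2 * N₁) → ZMod (2 * N₂) → ℝ :=
    fun m e => (u (m + 1) e - u m e) / doubleStep N₁ x m with ha
  have h1 := sum_sum_sq_comp_le (t := range N₂) Q₁.sum_sq_foldCell_le
    fun j m => foldCell N₂ y L₂ j (a m)
  have h2 : ∑ m, ∑ j ∈ range N₂, foldCell N₂ y L₂ j (a m) ^ 2 ≤
      78 * mult c * ∑ m, ∑ e, a m e ^ 2 := by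
    rw [mul_sum]
    exact sum_le_sum fun m _ => Q₂.sum_sq_foldCell_le (a m)
  have h3 : c ^ 2 * (H₁ * H₂ * ∑ m, ∑ e, a m e ^ 2) ≤ E := by
    refine le_trans ?_ hgrad
    simp only [mul_sum]
    refine sum_le_sum fun m _ => sum_le_sum fun e _ => ?_
    have b1 := Q₁.le_doubleStep m
    have b2 := Q₂.le_doubleStep e
    have b3 := (Q₁.doubleStep_pos m).le
    calc c ^ 2 * (H₁ * H₂ * a m e ^ 2) = (c * H₁) * (c * H₂) * a m e ^ 2 := by ring
      _ ≤ _ := by gcongr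
  have h4 : H₁ * H₂ * ∑ m, ∑ e, a m e ^ 2 ≤ 1 / c ^ 2 * E := by
    rw [one_div, inv_mul_eq_div, le_div_iff₀ (by positivity)]
    linarith
  have e0 : ∑ i ∈ range N₁, ∑ j ∈ range N₂,
      ((foldField N₁ x L₁ N₂ y L₂ u (i + 1) j - foldField N₁ x L₁ N₂ y L₂ u i j) /
        (x (i + 1) - x i)) ^ 2 = ∑ i ∈ range N₁, ∑ j ∈ range N₂,
        (foldCell N₁ x L₁ i fun m => foldCell N₂ y L₂ j (a m)) ^ 2 :=
    sum_congr rfl fun i hi => sum_congr rfl fun j _ => by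
      rw [Q₁.foldField_succ_sub_div u (mem_range.mp hi)]
  rw [e0]
  calc H₁ * H₂ * ∑ i ∈ range N₁, ∑ j ∈ range N₂,
        (foldCell N₁ x L₁ i fun m => foldCell N₂ y L₂ j (a m)) ^ 2
      ≤ H₁ * H₂ * (78 * mult c * (78 * mult c * ∑ m, ∑ e, a m e ^ 2)) := by
        gcongr
        exact h1.trans (by gcongr)
    _ = 6084 * mult c ^ 2 * (H₁ * H₂ * ∑ m, ∑ e, a m e ^ 2) := by ring
    _ ≤ 44928 * mult c ^ 3 * (1 / c ^ 2 * E) := by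
        gcongr
        · norm_num
        · norm_num
    _ ≤ foldConst c L₁ L₂ * E := by
        rw [foldConst, ← mul_assoc]
        gcongr
        have : 0 ≤ 1 + 4 * L₁ ^ 2 / c ^ 3 + 4 * L₁ ^ 2 / (c ^ 3 * L₂ ^ 2) := by positivity
        linarith

lemma sum_sq_foldField_jump_le (Q₁ : QuasiUniform N₁ x L₁ H₁ c) (Q₂ : QuasiUniform N₂ y L₂ H₂ c)
    (hgrad : ∑ m, ∑ e, doubleStep N₁ x m * doubleStep N₂ y e *
      ((u (m + 1) e - u m e) / doubleStep N₁ x m) ^ 2 ≤ E)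
    (hmean : ∀ e, ∑ m, u m e = 0)
    (hcross : H₁ / H₂ * ∑ m, ∑ e, (u m e - u m (e - 1)) ^ 2 ≤ E) :
    H₁ / H₂ * ∑ i ∈ range (N₁ + 1), ∑ j ∈ range (N₂ + 1),
      ((if j < N₂ then foldField N₁ x L₁ N₂ y L₂ u i j else 0) -
        (if j = 0 then 0 else foldField N₁ x L₁ N₂ y L₂ u i (j - 1))) ^ 2 ≤
      foldConst c L₁ L₂ * E := by
  have hc := Q₁.c_pos
  have hH₁ := Q₁.H_pos
  have hH₂ := Q₂.H_pos
  have hL₂ := Q₂.L_pos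
  have hK := Q₁.one_le_mult
  have hE := Q₁.energy_nonneg Q₂ hgrad
  have h := Q₁.mul_mul_sum_sq_le Q₂ hgrad hmean
  simp only [foldField_jump]
  have h1 := sum_sum_sq_comp_le (t := range (N₂ + 1)) Q₁.sum_sq_foldNode_le
    fun j m => foldJump N₂ y L₂ j (u m)
  have h2 : ∑ m, ∑ j ∈ range (N₂ + 1), foldJump N₂ y L₂ j (u m) ^ 2 ≤
      576 * mult c ^ 2 * (∑ m, ∑ e, (u m e - u m (e - 1)) ^ 2 +
        (H₂ / L₂) ^ 2 * ∑ m, ∑ e, u m e ^ 2) := by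
    refine (sum_le_sum fun m _ => Q₂.sum_sq_foldJump_le (u m)).trans_eq ?_
    rw [← mul_sum, sum_add_distrib, ← mul_sum]
  calc H₁ / H₂ * ∑ i ∈ range (N₁ + 1), ∑ j ∈ range (N₂ + 1),
        (foldNode N₁ x L₁ i fun m => foldJump N₂ y L₂ j (u m)) ^ 2
      ≤ H₁ / H₂ * (78 * mult c * (576 * mult c ^ 2 * (∑ m, ∑ e, (u m e - u m (e - 1)) ^ 2 +
        (H₂ / L₂) ^ 2 * ∑ m, ∑ e, u m e ^ 2))) := by
        gcongr
        exact h1.trans (by gcongr)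
    _ = 44928 * mult c ^ 3 * (H₁ / H₂ * ∑ m, ∑ e, (u m e - u m (e - 1)) ^ 2 +
        1 / L₂ ^ 2 * (H₁ * H₂ * ∑ m, ∑ e, u m e ^ 2)) := by
        field_simp
        ring
    _ ≤ 44928 * mult c ^ 3 * (E + 1 / L₂ ^ 2 * (4 * L₁ ^ 2 / c ^ 3 * E)) := by gcongr
    _ = 44928 * mult c ^ 3 * (1 + 4 * L₁ ^ 2 / (c ^ 3 * L₂ ^ 2)) * E := by
        field_simp
    _ ≤ foldConst c L₁ L₂ * E := by
        rw [foldConst]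
        gcongr
        have : 0 ≤ 1 / c ^ 2 + 4 * L₁ ^ 2 / c ^ 3 := by positivity
        linarith

end Bounds

end QuasiUniform

end RMAC

namespace RMAC

/-- A grid function on `ℤ × ℤ` from the values at `0 ≤ i ≤ N`, `0 ≤ j < M`. -/
def extendInt (N M : ℕ) (V : ℕ → ℕ → ℝ) (i j : ℤ) : ℝ :=
  if 0 ≤ i ∧ i ≤ N ∧ 0 ≤ j ∧ j < M then V i.toNat j.toNat else 0

lemma extendInt_natCast {N M : ℕ} (V : ℕ → ℕ → ℝ) {i : ℕ} (hi : i ≤ N) (j : ℕ) :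
    extendInt N M V i j = if j < M then V i j else 0 := by
  simp [extendInt, hi]

lemma extendInt_natCast_sub_one {N M : ℕ} (V : ℕ → ℕ → ℝ) {i : ℕ} (hi : i ≤ N) {j : ℕ}
    (hj : j ≤ M) : extendInt N M V i ((j : ℤ) - 1) = if j = 0 then 0 else V i (j - 1) := by
  rcases j with _ | j
  · simp [extendInt]
  · rw [Nat.cast_succ, add_sub_cancel_right, extendInt_natCast V hi, if_pos (by omega),
      if_neg (by omega), Nat.add_sub_cancel]

lemma sum_Icc_eq_sum_range (N : ℕ) (f : ℤ → ℝ) :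
    ∑ i ∈ Icc (0 : ℤ) ((N : ℤ) - 1), f i = ∑ i ∈ range N, f i := by
  refine (sum_bij (fun (i : ℕ) _ => (i : ℤ)) ?_ ?_ ?_ ?_).symm
  · intro i hi
    have := mem_range.mp hi
    exact mem_Icc.mpr ⟨by omega, by omega⟩
  · intro i _ j _ h
    exact_mod_cast h
  · intro i hi
    have := mem_Icc.mp hi
    exact ⟨i.toNat, mem_range.mpr (by omega), by omega⟩
  · exact fun _ _ => rfl

lemma sum_Icc_le_sum_range {a b : ℤ} {N : ℕ} (ha : 0 ≤ a) (hb : b < N) {f : ℤ → ℝ} {g : ℕ → ℝ}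
    (hfg : ∀ i : ℕ, a ≤ i → (i : ℤ) ≤ b → f i ≤ g i) (hg : ∀ i, 0 ≤ g i) :
    ∑ i ∈ Icc a b, f i ≤ ∑ i ∈ range N, g i := by
  calc ∑ i ∈ Icc a b, f i ≤ ∑ i ∈ Icc a b, g i.toNat := sum_le_sum fun i hi => by
        have hi := mem_Icc.mp hi
        have h := hfg i.toNat (by omega) (by omega)
        rwa [Int.toNat_of_nonneg (by omega)] at h
    _ ≤ ∑ i ∈ Icc (0 : ℤ) ((N : ℤ) - 1), g i.toNat :=
        sum_le_sum_of_subset_of_nonneg (Icc_subset_Icc ha (by omega)) fun _ _ _ => hg _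
    _ = _ := sum_Icc_eq_sum_range N fun i => g i.toNat

lemma sum_sum_Icc_le_sum_sum_range {a b a' b' : ℤ} {N M : ℕ} (ha : 0 ≤ a) (hb : b < N)
    (ha' : 0 ≤ a') (hb' : b' < M) {f : ℤ → ℤ → ℝ} {g : ℕ → ℕ → ℝ} {r : ℝ} (hr : 0 ≤ r)
    (hg : ∀ i j, 0 ≤ g i j)
    (hfg : ∀ i j : ℕ, a ≤ i → (i : ℤ) ≤ b → a' ≤ j → (j : ℤ) ≤ b' → f i j ≤ r * g i j) :
    ∑ i ∈ Icc a b, ∑ j ∈ Icc a' b', f i j ≤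
      r * ∑ i ∈ range N, ∑ j ∈ range M, g i j := by
  simp only [mul_sum]
  refine sum_Icc_le_sum_range (g := fun i => ∑ j ∈ range M, r * g i j) ha hb
    (fun i h1 h2 => ?_) fun i => sum_nonneg fun j _ => mul_nonneg hr (hg i j)
  exact sum_Icc_le_sum_range ha' hb' (hfg i · h1 h2) fun j => mul_nonneg hr (hg i j)

namespace Grid

variable (G : Grid)

/-- The grid with the two directions exchanged. -/
def swap : Grid where
  Nx := G.Ny
  Ny := G.Nx
  Lx := G.Ly
  Ly := G.Lx
  xp := G.yp
  yp := G.xp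
  one_le_Nx := G.one_le_Ny
  one_le_Ny := G.one_le_Nx
  xp_zero := G.yp_zero
  xp_last := G.yp_last
  yp_zero := G.xp_zero
  yp_last := G.xp_last
  xp_mono := G.yp_mono
  yp_mono := G.xp_mono

lemma Regular.swap {G : Grid} {C₀ : ℝ} (h : G.Regular C₀) : G.swap.Regular C₀ :=
  ⟨fun j h0 h1 => (h.2 j h0 h1).symm, fun i h0 h1 => (h.1 i h0 h1).symm⟩

lemma ipMT_swap (f g : ℤ → ℤ → ℝ) :
    G.ipMT f g = G.swap.ipTM (fun j i => f i j) (fun j i => g i j) := by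
  rw [ipMT, ipTM, sum_comm]
  refine sum_congr rfl fun j _ => sum_congr rfl fun i _ => ?_
  change _ = G.kc j * G.hh i * f i j * g i j
  ring

lemma ipTx_swap (f g : ℤ → ℤ → ℝ) :
    G.ipTx f g = G.swap.ipTy (fun j i => f i j) (fun j i => g i j) := by
  rw [ipTx, ipTy, sum_comm]
  refine sum_congr rfl fun j _ => sum_congr rfl fun i _ => ?_
  change _ = G.kc j * G.hc i * f i j * g i j
  ring

lemma ipM_swap (f g : ℤ → ℤ → ℝ) :
    G.ipM f g = G.swap.ipM (fun j i => f i j) (fun j i => g i j) := by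
  rw [ipM, ipM, sum_comm]
  refine sum_congr rfl fun j _ => sum_congr rfl fun i _ => ?_
  change _ = G.kk j * G.hh i * f i j * g i j
  ring

/-- The partition in the first direction, with natural indices. -/
def xn (n : ℕ) : ℝ := G.xp n

/-- The partition in the second direction, with natural indices. -/
def yn (n : ℕ) : ℝ := G.yp n

lemma hh_natCast (i : ℕ) : G.hh i = G.xn (i + 1) - G.xn i := by
  simp [hh, xn]

lemma kk_natCast (j : ℕ) : G.kk j = G.yn (j + 1) - G.yn j := G.swap.hh_natCast j

lemma hh_le_hmax {i : ℤ} (h0 : 0 ≤ i) (h1 : i < G.Nx) : G.hh i ≤ G.hmax :=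
  le_sup' G.hh (mem_Icc.mpr ⟨h0, by omega⟩)

lemma Regular.quasiUniform_x {G : Grid} {C₀ : ℝ} (h : G.Regular C₀) (hC₀ : 0 < C₀) :
    QuasiUniform G.Nx G.xn G.Lx G.hmax C₀ where
  one_le := G.one_le_Nx
  c_pos := hC₀
  H_pos := by
    have h1 : (0 : ℤ) < G.Nx := by exact_mod_cast G.one_le_Nx
    exact (sub_pos.mpr (G.xp_mono 0 le_rfl h1)).trans_le (G.hh_le_hmax le_rfl h1)
  zero := G.xp_zero
  last := G.xp_last
  lower j hj := by
    rw [← hh_natCast]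
    exact (h.1 j (by omega) (by omega)).1
  upper j hj := by
    rw [← hh_natCast]
    exact G.hh_le_hmax (by omega) (by omega)

lemma Regular.quasiUniform_y {G : Grid} {C₀ : ℝ} (h : G.Regular C₀) (hC₀ : 0 < C₀) :
    QuasiUniform G.Ny G.yn G.Ly G.kmax C₀ := h.swap.quasiUniform_x hC₀

lemma Regular.hc_bounds {G : Grid} {C₀ : ℝ} (h : G.Regular C₀) (hC₀ : 0 < C₀) {i : ℕ}
    (hi : i ≤ G.Nx) : C₀ * G.hmax / 2 ≤ G.hc i ∧ G.hc i ≤ G.hmax := by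
  have hN := G.one_le_Nx
  have hH := (h.quasiUniform_x hC₀).H_pos
  have hlow : ∀ j : ℤ, 0 ≤ j → j < G.Nx → C₀ * G.hmax ≤ G.hh j := fun j h0 h1 => (h.1 j h0 h1).1
  have hcH : 0 < C₀ * G.hmax := mul_pos hC₀ hH
  rw [hc]
  split_ifs with h0 h1
  · have a := hlow 0 le_rfl (by omega)
    have b := G.hh_le_hmax (i := 0) le_rfl (by omega)
    constructor <;> linarith
  · have a := hlow ((G.Nx : ℤ) - 1) (by omega) (by omega)
    have b := G.hh_le_hmax (i := (G.Nx : ℤ) - 1) (by omega) (by omega)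
    constructor <;> linarith
  · have a := hlow ((i : ℤ) - 1) (by omega) (by omega)
    have b := G.hh_le_hmax (i := (i : ℤ) - 1) (by omega) (by omega)
    have a' := hlow i (by omega) (by omega)
    have b' := G.hh_le_hmax (i := i) (by omega) (by omega)
    constructor <;> linarith

lemma Regular.kc_bounds {G : Grid} {C₀ : ℝ} (h : G.Regular C₀) (hC₀ : 0 < C₀) {j : ℕ}
    (hj : j ≤ G.Ny) : C₀ * G.kmax / 2 ≤ G.kc j ∧ G.kc j ≤ G.kmax := h.swap.hc_bounds hC₀ hj

section Component

variable {G} {C₀ : ℝ}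

lemma ipTM_extendInt_le (hreg : G.Regular C₀) (hC₀ : 0 < C₀) (V : ℕ → ℕ → ℝ) :
    G.ipTM (extendInt G.Nx G.Ny V) (extendInt G.Nx G.Ny V) ≤
      G.hmax * G.kmax * ∑ i ∈ range (G.Nx + 1), ∑ j ∈ range G.Ny, V i j ^ 2 := by
  have Q₁ := hreg.quasiUniform_x hC₀
  have Q₂ := hreg.quasiUniform_y hC₀
  have hH := Q₁.H_pos
  have hK := Q₂.H_pos
  refine sum_sum_Icc_le_sum_sum_range zero_le_one (by push_cast; omega) le_rfl (by omega)
    (by positivity) (fun _ _ => sq_nonneg _) fun i j h1 h2 h3 h4 => ?_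
  rw [extendInt_natCast V (by omega), if_pos (by omega), mul_assoc, ← sq, kk_natCast]
  have := (hreg.hc_bounds hC₀ (i := i) (by omega)).2
  have := Q₂.upper j (by omega)
  have := (Q₂.step_pos (j := j) (by omega)).le
  gcongr

lemma ipM_dxEx_extendInt_le (hreg : G.Regular C₀) (hC₀ : 0 < C₀) (V : ℕ → ℕ → ℝ) :
    G.ipM (G.dxEx (extendInt G.Nx G.Ny V)) (G.dxEx (extendInt G.Nx G.Ny V)) ≤
      G.hmax * G.kmax * ∑ i ∈ range G.Nx, ∑ j ∈ range G.Ny,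
        ((V (i + 1) j - V i j) / (G.xn (i + 1) - G.xn i)) ^ 2 := by
  have Q₁ := hreg.quasiUniform_x hC₀
  have Q₂ := hreg.quasiUniform_y hC₀
  have hH := Q₁.H_pos
  have hK := Q₂.H_pos
  refine sum_sum_Icc_le_sum_sum_range le_rfl (by omega) le_rfl (by omega)
    (by positivity) (fun _ _ => sq_nonneg _) fun i j h1 h2 h3 h4 => ?_
  have e := extendInt_natCast (N := G.Nx) (M := G.Ny) V (i := i + 1) (by omega) j
  push_cast at e
  rw [dxEx, e, extendInt_natCast V (by omega), if_pos (by omega), if_pos (by omega), mul_assoc,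
    ← sq, kk_natCast, hh_natCast]
  have := Q₁.upper i (by omega)
  have := Q₂.upper j (by omega)
  have := (Q₂.step_pos (j := j) (by omega)).le
  gcongr

lemma ipTy_DyEx_extendInt_le (hreg : G.Regular C₀) (hC₀ : 0 < C₀) (V : ℕ → ℕ → ℝ) :
    G.ipTy (G.DyEx (extendInt G.Nx G.Ny V)) (G.DyEx (extendInt G.Nx G.Ny V)) ≤
      2 / C₀ * (G.hmax / G.kmax * ∑ i ∈ range (G.Nx + 1), ∑ j ∈ range (G.Ny + 1),
        ((if j < G.Ny then V i j else 0) - (if j = 0 then 0 else V i (j - 1))) ^ 2) := by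
  have hH := (hreg.quasiUniform_x hC₀).H_pos
  have hK := (hreg.quasiUniform_y hC₀).H_pos
  rw [← mul_assoc]
  refine sum_sum_Icc_le_sum_sum_range zero_le_one (by push_cast; omega) le_rfl
    (by push_cast; omega) (by positivity) (fun _ _ => sq_nonneg _) fun i j h1 h2 h3 h4 => ?_
  rw [DyEx, extendInt_natCast V (by omega), extendInt_natCast_sub_one V (by omega) (by omega)]
  have hi := (hreg.hc_bounds hC₀ (i := i) (by omega)).2
  have hj := (hreg.kc_bounds hC₀ (j := j) (by omega)).1
  generalize (if j < G.Ny then V i j else 0) - (if j = 0 then 0 else V i (j - 1)) = d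
  have hpos : 0 < C₀ * G.kmax / 2 := by positivity
  have hk := hpos.trans_le hj
  calc G.hc i * G.kc j * (d / G.kc j) * (d / G.kc j) = G.hc i * d ^ 2 / G.kc j := by
        field_simp
    _ ≤ G.hmax * d ^ 2 / (C₀ * G.kmax / 2) := by gcongr
    _ = _ := by field_simp

end Component

end Grid

/-- Every cell function of zero mean on a quasi-uniform rectangle is the discrete divergence of a
discrete velocity with zero boundary values, obtained by folding a field on the double. -/
lemma exists_foldField {N₁ N₂ : ℕ} {x y : ℕ → ℝ} {L₁ L₂ H₁ H₂ c : ℝ} [NeZero (2 * N₁)]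
    [NeZero (2 * N₂)] (Q₁ : QuasiUniform N₁ x L₁ H₁ c) (Q₂ : QuasiUniform N₂ y L₂ H₂ c)
    (q : ℕ → ℕ → ℝ) {E : ℝ}
    (hq : ∑ i ∈ range N₁, ∑ j ∈ range N₂, (x (i + 1) - x i) * (y (j + 1) - y j) * q i j = 0)
    (hE : ∑ i ∈ range N₁, ∑ j ∈ range N₂, (x (i + 1) - x i) * (y (j + 1) - y j) * q i j ^ 2 = E) :
    ∃ (u : ZMod (2 * N₁) → ZMod (2 * N₂) → ℝ) (v : ZMod (2 * N₂) → ZMod (2 * N₁) → ℝ),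
      (∀ i < N₁, ∀ j < N₂,
        (foldField N₁ x L₁ N₂ y L₂ u (i + 1) j - foldField N₁ x L₁ N₂ y L₂ u i j) /
          (x (i + 1) - x i) +
        (foldField N₂ y L₂ N₁ x L₁ v (j + 1) i - foldField N₂ y L₂ N₁ x L₁ v j i) /
          (y (j + 1) - y j) = q i j) ∧
      (∀ e, ∑ m, u m e = 0) ∧ (∀ m, ∑ e, v e m = 0) ∧
      (∑ m, ∑ e, doubleStep N₁ x m * doubleStep N₂ y e *
        ((u (m + 1) e - u m e) / doubleStep N₁ x m) ^ 2 ≤ E) ∧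
      (∑ e, ∑ m, doubleStep N₂ y e * doubleStep N₁ x m *
        ((v (e + 1) m - v e m) / doubleStep N₂ y e) ^ 2 ≤ E) ∧
      (H₁ / H₂ * ∑ m, ∑ e, (u m e - u m (e - 1)) ^ 2 ≤ E) ∧
      (H₂ / H₁ * ∑ e, ∑ m, (v e m - v e (m - 1)) ^ 2 ≤ E) := by
  have hq' := (sum_sum_extendZero x y q (φ := id) rfl).trans hq
  have hE' := (sum_sum_extendZero x y q (φ := fun t => t ^ 2) (zero_pow two_ne_zero)).trans hE
  obtain ⟨u, v, hdiv, hu, hv, hu', hv', hu0, hv0⟩ := exists_torus_field Q₁.doubleStep_pos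
    Q₂.doubleStep_pos Q₁.H_pos Q₂.H_pos (extendZero N₁ N₂ q) hq'
  rw [hE'] at hu hv hu' hv'
  refine ⟨u, fun e m => v m e, fun i hi j hj => ?_, hu0, hv0, hu, ?_, hu', ?_⟩
  · rw [Q₁.foldField_succ_sub_div u hi, Q₂.foldField_succ_sub_div _ hj,
      apply_apply_comm (foldCell N₂ y L₂ j) (foldCell N₁ x L₁ i), ← map_add,
      ← foldCell_extendZero x y L₁ L₂ q hi hj]
    congr 1
    funext m
    rw [Pi.add_apply, ← map_add]
    congr 1
    funext e
    exact hdiv m e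
  · rw [sum_comm]
    simpa only [mul_comm (doubleStep N₂ y _)] using hv
  · rw [sum_comm]
    exact hv'

end RMAC

open RMAC

/-- discrete surjectivity of the divergence with uniform bound.
There is a constant `C` depending only on `Ω` and the mesh-regularity constant `C₀`
such that every cell-centered `q` with zero discrete mean is the discrete divergence of a
discrete velocity `v` with zero boundary values and `‖v‖_{l²} + ‖Dv‖_{l²} ≤ C ‖q‖_{l²,M}`. -/
theorem discrete_div_surjective (Lx Ly C₀ : ℝ) (hLx : 0 < Lx) (hLy : 0 < Ly) (hC₀ : 0 < C₀) :
    ∃ C : ℝ, 0 < C ∧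
      ∀ G : RMAC.Grid, G.Lx = Lx → G.Ly = Ly → G.Regular C₀ →
        ∀ q : ℤ → ℤ → ℝ, G.ipM q (fun _ _ => 1) = 0 →
          ∃ vx vy : ℤ → ℤ → ℝ,
            (∀ j : ℤ, vx 0 j = 0 ∧ vx (G.Nx : ℤ) j = 0) ∧
            (∀ i : ℤ, vx i (-1) = 0 ∧ vx i (G.Ny : ℤ) = 0) ∧
            (∀ i : ℤ, vy i 0 = 0 ∧ vy i (G.Ny : ℤ) = 0) ∧
            (∀ j : ℤ, vy (-1) j = 0 ∧ vy (G.Nx : ℤ) j = 0) ∧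
            (∀ i ∈ Finset.Icc (0 : ℤ) ((G.Nx : ℤ) - 1),
              ∀ j ∈ Finset.Icc (0 : ℤ) ((G.Ny : ℤ) - 1),
                G.dxEx vx i j + G.dyEy vy i j = q i j) ∧
            Real.sqrt (G.velNormSq vx vy) + Real.sqrt (G.DvelNormSq vx vy) ≤
              C * Real.sqrt (G.ipM q q) := by
  set B := foldConst C₀ Lx Ly + foldConst C₀ Ly Lx with hB
  have hBpos : 0 < B := add_pos (foldConst_pos hC₀ _ _) (foldConst_pos hC₀ _ _)
  refine ⟨√B + √((1 + 2 / C₀) * B), by positivity, ?_⟩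
  rintro G rfl rfl hreg q hq
  have Q₁ := hreg.quasiUniform_x hC₀
  have Q₂ := hreg.quasiUniform_y hC₀
  have := Q₁.neZero_two_mul
  have := Q₂.neZero_two_mul
  have hsum : ∀ g : ℤ → ℤ → ℝ, G.ipM q g = ∑ i ∈ range G.Nx, ∑ j ∈ range G.Ny,
      (G.xn (i + 1) - G.xn i) * (G.yn (j + 1) - G.yn j) * (q i j * g i j) := by
    intro g
    simp only [Grid.ipM, sum_Icc_eq_sum_range, Grid.hh_natCast, Grid.kk_natCast, mul_assoc]
  obtain ⟨u, v, hdiv, hu0, hv0, hu, hv, hu', hv'⟩ := exists_foldField Q₁ Q₂ (fun i j => q i j)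
    (E := G.ipM q q) (by rw [hsum] at hq; simpa only [mul_one] using hq)
    (by rw [hsum]; simp only [sq])
  have hE := Q₁.energy_nonneg Q₂ hu
  set E := G.ipM q q
  set V := foldField G.Nx G.xn G.Lx G.Ny G.yn G.Ly u with hV
  set W := foldField G.Ny G.yn G.Ly G.Nx G.xn G.Lx v with hW
  have hV0 : ∀ j, V 0 j = 0 := Q₁.foldField_zero u
  have hVN : ∀ j, V G.Nx j = 0 := Q₁.foldField_last u
  have hW0 : ∀ i, W 0 i = 0 := Q₂.foldField_zero v
  have hWN : ∀ i, W G.Ny i = 0 := Q₂.foldField_last v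
  have t1 := (Grid.ipTM_extendInt_le hreg hC₀ V).trans (Q₁.sum_sq_foldField_le Q₂ hu hu0)
  have t2 := (Grid.ipM_dxEx_extendInt_le hreg hC₀ V).trans (Q₁.sum_sq_foldField_diff_le Q₂ hu)
  have t3 := (Grid.ipTy_DyEx_extendInt_le hreg hC₀ V).trans (mul_le_mul_of_nonneg_left
    (Q₁.sum_sq_foldField_jump_le Q₂ hu hu0 hu') (by positivity : 0 ≤ 2 / C₀))
  have hW₁ := Q₂.sum_sq_foldField_le Q₁ hv hv0
  have hW₂ := Q₂.sum_sq_foldField_diff_le Q₁ hv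
  have hW₃ := Q₂.sum_sq_foldField_jump_le Q₁ hv hv0 hv'
  have s1 := (Grid.ipTM_extendInt_le hreg.swap hC₀ W).trans hW₁
  have s2 := (Grid.ipM_dxEx_extendInt_le hreg.swap hC₀ W).trans hW₂
  have s3 := (Grid.ipTy_DyEx_extendInt_le hreg.swap hC₀ W).trans
    (mul_le_mul_of_nonneg_left hW₃ (by positivity : 0 ≤ 2 / C₀))
  have hboundary : ∀ (N M : ℕ) (V : ℕ → ℕ → ℝ), (∀ j, V 0 j = 0) → (∀ j, V N j = 0) →
      (∀ j : ℤ, extendInt N M V 0 j = 0 ∧ extendInt N M V N j = 0) ∧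
      (∀ i : ℤ, extendInt N M V i (-1) = 0 ∧ extendInt N M V i M = 0) := by
    intro N M V h0 hN
    simp [extendInt, h0, hN]
  obtain ⟨b1, b2⟩ := hboundary G.Nx G.Ny V hV0 hVN
  obtain ⟨b3, b4⟩ := hboundary G.Ny G.Nx W hW0 hWN
  refine ⟨extendInt G.Nx G.Ny V, fun i j => extendInt G.Ny G.Nx W j i, b1, b2, b3, b4, ?_, ?_⟩
  · intro i hi j hj
    rw [mem_Icc] at hi hj
    lift i to ℕ using hi.1
    lift j to ℕ using hj.1
    have e1 := extendInt_natCast (N := G.Nx) (M := G.Ny) V (i := i + 1) (by omega) j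
    have e2 := extendInt_natCast (N := G.Ny) (M := G.Nx) W (i := j + 1) (by omega) i
    push_cast at e1 e2
    rw [Grid.dxEx, Grid.dyEy, e1, e2, extendInt_natCast V (by omega),
      extendInt_natCast W (by omega), if_pos (by omega), if_pos (by omega), if_pos (by omega),
      if_pos (by omega), Grid.hh_natCast, Grid.kk_natCast]
    exact hdiv i (by omega) j (by omega)
  · have n1 : G.velNormSq (extendInt G.Nx G.Ny V) (fun i j => extendInt G.Ny G.Nx W j i) ≤
        B * E := by
      rw [Grid.velNormSq, Grid.ipMT_swap, hB, add_mul]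
      exact add_le_add t1 s1
    have n2 : G.DvelNormSq (extendInt G.Nx G.Ny V) (fun i j => extendInt G.Ny G.Nx W j i) ≤
        (1 + 2 / C₀) * B * E := by
      rw [Grid.DvelNormSq, Grid.ipTx_swap, G.ipM_swap (G.dyEy _)]
      have := add_le_add (add_le_add (add_le_add t2 t3) s3) s2
      refine this.trans_eq ?_
      rw [hB]
      ring
    rw [add_mul, ← Real.sqrt_mul hBpos.le, ← Real.sqrt_mul (by positivity)]
    exact add_le_add (Real.sqrt_le_sqrt n1) (Real.sqrt_le_sqrt n2)
end
end

section
/- Pressure-robust velocity stability of the RMAC scheme: let (u,p) be a smooth solution of the Stokes problem with source g and set β=(β^x,β^y)=g−∇p (=∂_t u − μΔu). Define the cell averages β̂^{x,n}_{i,j+1/2}=(1/h_i)∫_{x_{i-1/2}}^{x_{i+1/2}}β^x(x,y_{j+1/2},t^n)dx, β̂^{y,n}_{i+1/2,j}=(1/k_j)∫_{y_{j-1/2}}^{y_{j+1/2}}β^y(x_{i+1/2},y,t^n)dy, and ‖β̂^n‖²_{l2}=‖β̂^{x,n}‖²_{l2,T,M}+‖β̂^{y,n}‖²_{l2,M,T}.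 Then, for Δt sufficiently small, there exists a constant C independent of the viscosity μ and of h, k, Δt such that the RMAC solution satisfies ‖W^m‖²_{l2} ≤ C·Σ_{n=1}^{m} Δt·‖β̂^n‖²_{l2} for every 1 ≤ m ≤ N. -/
open Finset MeasureTheory Real

noncomputable section

open RMAC

namespace RMAC

/-! ### Regularity of slices -/

lemma Smooth.pdx {f : ℝ → ℝ → ℝ → ℝ} (hf : Smooth f) : Smooth (pdx f) := by
  intro n
  have h : (fun q : ℝ × ℝ × ℝ => RMAC.pdx f q.1 q.2.1 q.2.2) = fun q =>
      fderiv ℝ (fun q : ℝ × ℝ × ℝ => f q.1 q.2.1 q.2.2) q (1, 0, 0) := by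
    funext q
    have hd := ((hf 1).differentiable (by simp) q).hasFDerivAt
    have hc : HasDerivAt (fun s : ℝ => (s, q.2.1, q.2.2)) ((1 : ℝ), (0 : ℝ), (0 : ℝ)) q.1 :=
      (hasDerivAt_id q.1).prodMk ((hasDerivAt_const _ _).prodMk (hasDerivAt_const _ _))
    exact (hd.comp_hasDerivAt q.1 hc).deriv
  rw [h]
  exact ((hf (n + 1)).fderiv_right (m := n) (by norm_cast)).clm_apply contDiff_const

lemma Smooth.pdy {f : ℝ → ℝ → ℝ → ℝ} (hf : Smooth f) : Smooth (pdy f) := by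
  intro n
  have h : (fun q : ℝ × ℝ × ℝ => RMAC.pdy f q.1 q.2.1 q.2.2) = fun q =>
      fderiv ℝ (fun q : ℝ × ℝ × ℝ => f q.1 q.2.1 q.2.2) q (0, 1, 0) := by
    funext q
    have hd := ((hf 1).differentiable (by simp) q).hasFDerivAt
    have hc : HasDerivAt (fun s : ℝ => (q.1, s, q.2.2)) ((0 : ℝ), (1 : ℝ), (0 : ℝ)) q.2.1 :=
      (hasDerivAt_const _ _).prodMk ((hasDerivAt_id q.2.1).prodMk (hasDerivAt_const _ _))
    exact (hd.comp_hasDerivAt q.2.1 hc).deriv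
  rw [h]
  exact ((hf (n + 1)).fderiv_right (m := n) (by norm_cast)).clm_apply contDiff_const

lemma Smooth.pdt {f : ℝ → ℝ → ℝ → ℝ} (hf : Smooth f) : Smooth (pdt f) := by
  intro n
  have h : (fun q : ℝ × ℝ × ℝ => RMAC.pdt f q.1 q.2.1 q.2.2) = fun q =>
      fderiv ℝ (fun q : ℝ × ℝ × ℝ => f q.1 q.2.1 q.2.2) q (0, 0, 1) := by
    funext q
    have hd := ((hf 1).differentiable (by simp) q).hasFDerivAt
    have hc : HasDerivAt (fun s : ℝ => (q.1, q.2.1, s)) ((0 : ℝ), (0 : ℝ), (1 : ℝ)) q.2.2 :=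
      (hasDerivAt_const _ _).prodMk ((hasDerivAt_const _ _).prodMk (hasDerivAt_id q.2.2))
    exact (hd.comp_hasDerivAt q.2.2 hc).deriv
  rw [h]
  exact ((hf (n + 1)).fderiv_right (m := n) (by norm_cast)).clm_apply contDiff_const

lemma Smooth.contDiff_slice_x {f : ℝ → ℝ → ℝ → ℝ} (hf : Smooth f) (y t : ℝ) :
    ContDiff ℝ 1 (fun x => f x y t) :=
  (hf 1).comp (contDiff_id.prodMk (contDiff_const (c := (y, t))))

lemma Smooth.contDiff_slice_y {f : ℝ → ℝ → ℝ → ℝ} (hf : Smooth f) (x t : ℝ) :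
    ContDiff ℝ 1 (fun y => f x y t) :=
  (hf 1).comp (contDiff_const.prodMk (contDiff_id.prodMk (contDiff_const (c := t))))

/-- Integrating `g - φ'` when `g` agrees on the interval with a continuous function. -/
lemma integral_sub_deriv {g s φ : ℝ → ℝ} {a b : ℝ} (hs : Continuous s) (hφ : ContDiff ℝ 1 φ)
    (hg : ∀ x ∈ Set.uIcc a b, g x = s x) :
    ∫ x in a..b, (g x - deriv φ x) = (∫ x in a..b, g x) - (φ b - φ a) := by
  have hφ' : Continuous (deriv φ) := hφ.continuous_deriv_one
  rw [intervalIntegral.integral_congr (g := fun x => s x - deriv φ x)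
      (fun x hx => by simp only [hg x hx]), intervalIntegral.integral_congr (f := g) (g := s) hg,
    intervalIntegral.integral_sub (hs.intervalIntegrable a b) (hφ'.intervalIntegrable a b),
    intervalIntegral.integral_deriv_eq_sub (fun x _ => hφ.differentiable (by simp) x)
      (hφ'.intervalIntegrable a b)]

/-! ### Summation by parts -/

lemma sum_int_Icc_succ_top {a b : ℤ} (hab : a ≤ b + 1) (f : ℤ → ℝ) :
    ∑ i ∈ Icc a (b + 1), f i = ∑ i ∈ Icc a b, f i + f (b + 1) := by
  have h : Icc a (b + 1) = insert (b + 1) (Icc a b) := by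
    ext x; simp only [mem_insert, mem_Icc]; omega
  rw [h, sum_insert (by simp), add_comm]

lemma sum_mul_sub_pred {N : ℕ} (hN : 1 ≤ N) (f q : ℤ → ℝ) (h0 : f 0 = 0) (h1 : f N = 0) :
    ∑ i ∈ Icc (1 : ℤ) (N - 1), f i * (q i - q (i - 1)) =
      -∑ i ∈ Icc (0 : ℤ) (N - 1), (f (i + 1) - f i) * q i := by
  have key : ∀ K : ℕ, ∑ i ∈ Icc (1 : ℤ) K, f i * (q i - q (i - 1)) +
      ∑ i ∈ Icc (0 : ℤ) K, (f (i + 1) - f i) * q i = f (K + 1) * q K - f 0 * q 0 := by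
    intro K
    induction K with
    | zero => simp; ring
    | succ K ih =>
      push_cast
      rw [sum_int_Icc_succ_top (by omega), sum_int_Icc_succ_top (by omega), add_sub_cancel_right]
      linarith
  obtain ⟨K, rfl⟩ : ∃ K, N = K + 1 := ⟨N - 1, by omega⟩
  have := key K
  push_cast at h1 ⊢
  rw [h0, h1] at this
  rw [add_sub_cancel_right]
  linarith

lemma sum_mul_succ_sub {N : ℕ} (hN : 1 ≤ N) (f q : ℤ → ℝ) (h0 : f (-1) = 0) (h1 : f N = 0) :
    ∑ j ∈ Icc (0 : ℤ) (N - 1), f j * (q (j + 1) - q j) =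
      -∑ j ∈ Icc (0 : ℤ) N, (f j - f (j - 1)) * q j := by
  have key : ∀ K : ℕ, ∑ j ∈ Icc (0 : ℤ) K, f j * (q (j + 1) - q j) +
      ∑ j ∈ Icc (0 : ℤ) K, (f j - f (j - 1)) * q j = f K * q (K + 1) - f (-1) * q 0 := by
    intro K
    induction K with
    | zero => simp; ring
    | succ K ih =>
      push_cast
      rw [sum_int_Icc_succ_top (by omega), sum_int_Icc_succ_top (by omega), add_sub_cancel_right]
      linarith
  obtain ⟨K, rfl⟩ : ∃ K, N = K + 1 := ⟨N - 1, by omega⟩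
  have := key K
  push_cast at h1 ⊢
  rw [add_sub_cancel_right, sum_int_Icc_succ_top (by omega), add_sub_cancel_right, h1]
  rw [h0] at this
  linarith

/-- Nonpositivity of the discrete Laplacian with boundary values at grid points. -/
lemma sum_mul_laplacian_node_nonpos {N : ℕ} (hN : 1 ≤ N) (f w : ℤ → ℝ) (h0 : f 0 = 0)
    (h1 : f N = 0) (hw : ∀ i ∈ Icc (0 : ℤ) (N - 1), 0 ≤ w i) :
    ∑ i ∈ Icc (1 : ℤ) (N - 1),
      f i * ((f (i + 1) - f i) / w i - (f (i - 1 + 1) - f (i - 1)) / w (i - 1)) ≤ 0 := by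
  rw [sum_mul_sub_pred hN f (fun i => (f (i + 1) - f i) / w i) h0 h1, neg_nonpos]
  refine sum_nonneg fun i hi => ?_
  rw [← mul_div_assoc]
  exact div_nonneg (mul_self_nonneg _) (hw i hi)

/-- Nonpositivity of the discrete Laplacian with ghost boundary values. -/
lemma sum_mul_laplacian_ghost_nonpos {N : ℕ} (hN : 1 ≤ N) (f w : ℤ → ℝ) (h0 : f (-1) = 0)
    (h1 : f N = 0) (hw : ∀ i ∈ Icc (0 : ℤ) N, 0 ≤ w i) :
    ∑ j ∈ Icc (0 : ℤ) (N - 1),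
      f j * ((f (j + 1) - f (j + 1 - 1)) / w (j + 1) - (f j - f (j - 1)) / w j) ≤ 0 := by
  rw [sum_mul_succ_sub hN f (fun i => (f i - f (i - 1)) / w i) h0 h1, neg_nonpos]
  refine sum_nonneg fun i hi => ?_
  rw [← mul_div_assoc]
  exact div_nonneg (mul_self_nonneg _) (hw i hi)

/-! ### Weighted double sums -/

lemma two_mul_weighted_sum_le {s t : Finset ℤ} {w f g : ℤ → ℤ → ℝ}
    (hw : ∀ i ∈ s, ∀ j ∈ t, 0 ≤ w i j) :
    2 * ∑ i ∈ s, ∑ j ∈ t, w i j * f i j * g i j ≤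
      ∑ i ∈ s, ∑ j ∈ t, w i j * f i j * f i j + ∑ i ∈ s, ∑ j ∈ t, w i j * g i j * g i j := by
  simp only [mul_sum, ← sum_add_distrib]
  refine sum_le_sum fun i hi => sum_le_sum fun j hj => ?_
  nlinarith [mul_nonneg (hw i hi j hj) (sq_nonneg (f i j - g i j))]

lemma weighted_sum_sq_add_le {s t : Finset ℤ} {w f g : ℤ → ℤ → ℝ}
    (hw : ∀ i ∈ s, ∀ j ∈ t, 0 ≤ w i j) (r c : ℝ) :
    r * ∑ i ∈ s, ∑ j ∈ t, w i j * (f i j + c * g i j) * (f i j + c * g i j) ≤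
      (1 + r) * ∑ i ∈ s, ∑ j ∈ t, w i j * f i j * f i j +
        r * (1 + r) * c ^ 2 * ∑ i ∈ s, ∑ j ∈ t, w i j * g i j * g i j := by
  simp only [mul_sum, ← sum_add_distrib]
  refine sum_le_sum fun i hi => sum_le_sum fun j hj => ?_
  nlinarith [mul_nonneg (hw i hi j hj) (sq_nonneg (f i j - r * (c * g i j)))]

namespace Grid

variable (G : Grid)

/-! ### Geometry of the grid -/

lemma hh_pos {i : ℤ} (h0 : 0 ≤ i) (h1 : i < G.Nx) : 0 < G.hh i := sub_pos.2 (G.xp_mono i h0 h1)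

lemma kk_pos {j : ℤ} (h0 : 0 ≤ j) (h1 : j < G.Ny) : 0 < G.kk j := sub_pos.2 (G.yp_mono j h0 h1)

lemma hc_pos {i : ℤ} (h0 : 0 ≤ i) (h1 : i ≤ G.Nx) : 0 < G.hc i := by
  have hN := G.one_le_Nx
  unfold hc
  split_ifs with ha hb
  · exact half_pos (G.hh_pos le_rfl (by omega))
  · exact half_pos (G.hh_pos (by omega) (by omega))
  · exact half_pos (add_pos (G.hh_pos (by omega) (by omega)) (G.hh_pos h0 (by omega)))

lemma kc_pos {j : ℤ} (h0 : 0 ≤ j) (h1 : j ≤ G.Ny) : 0 < G.kc j := by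
  have hN := G.one_le_Ny
  unfold kc
  split_ifs with ha hb
  · exact half_pos (G.kk_pos le_rfl (by omega))
  · exact half_pos (G.kk_pos (by omega) (by omega))
  · exact half_pos (add_pos (G.kk_pos (by omega) (by omega)) (G.kk_pos h0 (by omega)))

lemma xp_nonneg {i : ℤ} (h0 : 0 ≤ i) (h1 : i ≤ G.Nx) : 0 ≤ G.xp i := by
  induction i, h0 using Int.leInduction with
  | base => rw [G.xp_zero]
  | succ i hi ih => exact (ih (by omega)).trans (G.xp_mono i hi (by omega)).le

lemma yp_nonneg {j : ℤ} (h0 : 0 ≤ j) (h1 : j ≤ G.Ny) : 0 ≤ G.yp j := by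
  induction j, h0 using Int.leInduction with
  | base => rw [G.yp_zero]
  | succ j hj ih => exact (ih (by omega)).trans (G.yp_mono j hj (by omega)).le

lemma xp_le_Lx {i : ℤ} (h0 : 0 ≤ i) (h1 : i ≤ G.Nx) : G.xp i ≤ G.Lx := by
  induction i, h1 using Int.leInductionDown with
  | base => rw [G.xp_last]
  | pred i hi ih =>
    have := G.xp_mono (i - 1) h0 (by omega)
    rw [sub_add_cancel] at this
    exact this.le.trans (ih (by omega))

lemma yp_le_Ly {j : ℤ} (h0 : 0 ≤ j) (h1 : j ≤ G.Ny) : G.yp j ≤ G.Ly := by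
  induction j, h1 using Int.leInductionDown with
  | base => rw [G.yp_last]
  | pred j hj ih =>
    have := G.yp_mono (j - 1) h0 (by omega)
    rw [sub_add_cancel] at this
    exact this.le.trans (ih (by omega))

lemma xh_mem_Ioo {i : ℤ} (h0 : 0 ≤ i) (h1 : i < G.Nx) : G.xh i ∈ Set.Ioo 0 G.Lx := by
  have ha := G.xp_mono i h0 h1
  have hb := G.xp_nonneg h0 h1.le
  have hc := G.xp_le_Lx (i := i + 1) (by omega) (by omega)
  constructor <;> unfold xh <;> linarith

lemma yh_mem_Ioo {j : ℤ} (h0 : 0 ≤ j) (h1 : j < G.Ny) : G.yh j ∈ Set.Ioo 0 G.Ly := by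
  have ha := G.yp_mono j h0 h1
  have hb := G.yp_nonneg h0 h1.le
  have hc := G.yp_le_Ly (j := j + 1) (by omega) (by omega)
  constructor <;> unfold yh <;> linarith

/-! ### The averaged source splits off a discrete gradient -/

lemma avgFx_sub_pdx {μ T Δt : ℝ} {ux uy p gx gy : ℝ → ℝ → ℝ → ℝ} (hux : Smooth ux)
    (hp : Smooth p) (hS : IsStokesSol μ G.Lx G.Ly T ux uy p gx gy) {n : ℕ}
    (hn : (n : ℝ) * Δt ∈ Set.Ioc 0 T) {i j : ℤ} (hi : i ∈ Icc (1 : ℤ) (G.Nx - 1))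
    (hj : j ∈ Icc (0 : ℤ) (G.Ny - 1)) :
    G.avgFx gx Δt n i j = G.avgFx (fun x y t => gx x y t - pdx p x y t) Δt n i j +
      G.DxC (fun a b => p (G.xh a) (G.yh b) (n * Δt)) i j := by
  rw [mem_Icc] at hi hj
  have hy := G.yh_mem_Ioo (j := j) (by omega) (by omega)
  have ha := G.xh_mem_Ioo (i := i - 1) (by omega) (by omega)
  have hb := G.xh_mem_Ioo (i := i) (by omega) (by omega)
  have h := integral_sub_deriv (g := fun x => gx x (G.yh j) (n * Δt))
    (s := fun x => pdt ux x (G.yh j) (n * Δt) - μ * (pdx (pdx ux) x (G.yh j) (n * Δt) +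
      pdy (pdy ux) x (G.yh j) (n * Δt)) + pdx p x (G.yh j) (n * Δt))
    (φ := fun x => p x (G.yh j) (n * Δt)) (a := G.xh (i - 1)) (b := G.xh i)
    (((hux.pdt.contDiff_slice_x _ _).continuous.sub (continuous_const.mul
      ((hux.pdx.pdx.contDiff_slice_x _ _).continuous.add
        (hux.pdy.pdy.contDiff_slice_x _ _).continuous))).add
      (hp.pdx.contDiff_slice_x _ _).continuous)
    (hp.contDiff_slice_x _ _)
    (fun x hx => ((hS.1 x (G.yh j) (n * Δt) (Set.ordConnected_Ioo.uIcc_subset ha hb hx)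
      hy hn).1).symm)
  unfold avgFx DxC
  simp only [pdx] at h ⊢
  rw [h]
  ring

lemma avgFy_sub_pdy {μ T Δt : ℝ} {ux uy p gx gy : ℝ → ℝ → ℝ → ℝ} (huy : Smooth uy)
    (hp : Smooth p) (hS : IsStokesSol μ G.Lx G.Ly T ux uy p gx gy) {n : ℕ}
    (hn : (n : ℝ) * Δt ∈ Set.Ioc 0 T) {i j : ℤ} (hi : i ∈ Icc (0 : ℤ) (G.Nx - 1))
    (hj : j ∈ Icc (1 : ℤ) (G.Ny - 1)) :
    G.avgFy gy Δt n i j = G.avgFy (fun x y t => gy x y t - pdy p x y t) Δt n i j +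
      G.DyC (fun a b => p (G.xh a) (G.yh b) (n * Δt)) i j := by
  rw [mem_Icc] at hi hj
  have hx := G.xh_mem_Ioo (i := i) (by omega) (by omega)
  have ha := G.yh_mem_Ioo (j := j - 1) (by omega) (by omega)
  have hb := G.yh_mem_Ioo (j := j) (by omega) (by omega)
  have h := integral_sub_deriv (g := fun y => gy (G.xh i) y (n * Δt))
    (s := fun y => pdt uy (G.xh i) y (n * Δt) - μ * (pdx (pdx uy) (G.xh i) y (n * Δt) +
      pdy (pdy uy) (G.xh i) y (n * Δt)) + pdy p (G.xh i) y (n * Δt))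
    (φ := fun y => p (G.xh i) y (n * Δt)) (a := G.yh (j - 1)) (b := G.yh j)
    (((huy.pdt.contDiff_slice_y _ _).continuous.sub (continuous_const.mul
      ((huy.pdx.pdx.contDiff_slice_y _ _).continuous.add
        (huy.pdy.pdy.contDiff_slice_y _ _).continuous))).add
      (hp.pdy.contDiff_slice_y _ _).continuous)
    (hp.contDiff_slice_y _ _)
    (fun y hy => ((hS.1 (G.xh i) y (n * Δt) hx (Set.ordConnected_Ioo.uIcc_subset ha hb hy)
      hn).2.1).symm)
  unfold avgFy DyC
  simp only [pdy] at h ⊢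
  rw [h]
  ring

/-! ### Discrete energy estimate -/

lemma momentum_x_energy {μ Δt : ℝ} (hμ : 0 < μ) (hΔ : 0 < Δt) {a a0 b z : ℤ → ℤ → ℝ}
    (hx : ∀ j, a 0 j = 0 ∧ a G.Nx j = 0) (hy : ∀ i, a i (-1) = 0 ∧ a i G.Ny = 0)
    (heq : ∀ i ∈ Icc (1 : ℤ) (G.Nx - 1), ∀ j ∈ Icc (0 : ℤ) (G.Ny - 1),
      (a i j - a0 i j) / Δt - μ * ((G.dxEx a i j - G.dxEx a (i - 1) j) / G.hc i)
        - μ * ((G.DyEx a i (j + 1) - G.DyEx a i j) / G.kk j) + G.DxC z i j = b i j) :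
    G.ipTM a a ≤ G.ipTM (fun i j => a0 i j + Δt * b i j) a + Δt * G.ipM (G.dxEx a) z := by
  have hdx : ∑ i ∈ Icc (1 : ℤ) (G.Nx - 1), ∑ j ∈ Icc (0 : ℤ) (G.Ny - 1),
      G.kk j * (a i j * (G.dxEx a i j - G.dxEx a (i - 1) j)) ≤ 0 := by
    rw [sum_comm]
    refine sum_nonpos fun j hj => ?_
    rw [mem_Icc] at hj
    rw [← mul_sum]
    refine mul_nonpos_of_nonneg_of_nonpos (G.kk_pos (by omega) (by omega)).le ?_
    exact sum_mul_laplacian_node_nonpos G.one_le_Nx (fun i => a i j) G.hh (hx j).1 (hx j).2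
      fun i hi => by rw [mem_Icc] at hi; exact (G.hh_pos (by omega) (by omega)).le
  have hdy : ∑ i ∈ Icc (1 : ℤ) (G.Nx - 1), ∑ j ∈ Icc (0 : ℤ) (G.Ny - 1),
      G.hc i * (a i j * (G.DyEx a i (j + 1) - G.DyEx a i j)) ≤ 0 := by
    refine sum_nonpos fun i hi => ?_
    rw [mem_Icc] at hi
    rw [← mul_sum]
    refine mul_nonpos_of_nonneg_of_nonpos (G.hc_pos (by omega) (by omega)).le ?_
    exact sum_mul_laplacian_ghost_nonpos G.one_le_Ny (fun j => a i j) G.kc (hy i).1 (hy i).2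
      fun j hj => by rw [mem_Icc] at hj; exact (G.kc_pos (by omega) (by omega)).le
  have hz : ∑ i ∈ Icc (1 : ℤ) (G.Nx - 1), ∑ j ∈ Icc (0 : ℤ) (G.Ny - 1),
      G.kk j * (a i j * (z i j - z (i - 1) j)) = -G.ipM (G.dxEx a) z := by
    unfold ipM
    rw [sum_comm, sum_comm (s := Icc (0 : ℤ) (G.Nx - 1)), ← sum_neg_distrib]
    refine sum_congr rfl fun j hj => ?_
    rw [← mul_sum, sum_mul_sub_pred G.one_le_Nx (fun i => a i j) (fun i => z i j) (hx j).1
      (hx j).2, mul_neg, mul_sum]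
    refine congrArg _ (sum_congr rfl fun i hi => ?_)
    rw [mem_Icc] at hi
    have := (G.hh_pos (i := i) (by omega) (by omega)).ne'
    unfold dxEx
    field_simp
  have hsum : G.ipTM a a = G.ipTM (fun i j => a0 i j + Δt * b i j) a +
      Δt * μ * (∑ i ∈ Icc (1 : ℤ) (G.Nx - 1), ∑ j ∈ Icc (0 : ℤ) (G.Ny - 1),
        G.kk j * (a i j * (G.dxEx a i j - G.dxEx a (i - 1) j))) +
      Δt * μ * (∑ i ∈ Icc (1 : ℤ) (G.Nx - 1), ∑ j ∈ Icc (0 : ℤ) (G.Ny - 1),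
        G.hc i * (a i j * (G.DyEx a i (j + 1) - G.DyEx a i j))) -
      Δt * (∑ i ∈ Icc (1 : ℤ) (G.Nx - 1), ∑ j ∈ Icc (0 : ℤ) (G.Ny - 1),
        G.kk j * (a i j * (z i j - z (i - 1) j))) := by
    unfold ipTM
    simp only [mul_sum, ← sum_add_distrib, ← sum_sub_distrib]
    refine sum_congr rfl fun i hi => sum_congr rfl fun j hj => ?_
    rw [← heq i hi j hj]
    rw [mem_Icc] at hi hj
    have h1 := (G.hc_pos (i := i) (by omega) (by omega)).ne'
    have h2 := (G.kk_pos (j := j) (by omega) (by omega)).ne'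
    unfold DxC
    field_simp
    ring
  have hm := mul_pos hΔ hμ
  rw [hsum, hz]
  nlinarith [mul_nonneg hm.le (neg_nonneg.2 hdx), mul_nonneg hm.le (neg_nonneg.2 hdy)]

lemma momentum_y_energy {μ Δt : ℝ} (hμ : 0 < μ) (hΔ : 0 < Δt) {a a0 b z : ℤ → ℤ → ℝ}
    (hy : ∀ i, a i 0 = 0 ∧ a i G.Ny = 0) (hx : ∀ j, a (-1) j = 0 ∧ a G.Nx j = 0)
    (heq : ∀ i ∈ Icc (0 : ℤ) (G.Nx - 1), ∀ j ∈ Icc (1 : ℤ) (G.Ny - 1),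
      (a i j - a0 i j) / Δt - μ * ((G.DxEy a (i + 1) j - G.DxEy a i j) / G.hh i)
        - μ * ((G.dyEy a i j - G.dyEy a i (j - 1)) / G.kc j) + G.DyC z i j = b i j) :
    G.ipMT a a ≤ G.ipMT (fun i j => a0 i j + Δt * b i j) a + Δt * G.ipM (G.dyEy a) z := by
  have hdy : ∑ i ∈ Icc (0 : ℤ) (G.Nx - 1), ∑ j ∈ Icc (1 : ℤ) (G.Ny - 1),
      G.hh i * (a i j * (G.dyEy a i j - G.dyEy a i (j - 1))) ≤ 0 := by
    refine sum_nonpos fun i hi => ?_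
    rw [mem_Icc] at hi
    rw [← mul_sum]
    refine mul_nonpos_of_nonneg_of_nonpos (G.hh_pos (by omega) (by omega)).le ?_
    exact sum_mul_laplacian_node_nonpos G.one_le_Ny (fun j => a i j) G.kk (hy i).1 (hy i).2
      fun j hj => by rw [mem_Icc] at hj; exact (G.kk_pos (by omega) (by omega)).le
  have hdx : ∑ i ∈ Icc (0 : ℤ) (G.Nx - 1), ∑ j ∈ Icc (1 : ℤ) (G.Ny - 1),
      G.kc j * (a i j * (G.DxEy a (i + 1) j - G.DxEy a i j)) ≤ 0 := by
    rw [sum_comm]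
    refine sum_nonpos fun j hj => ?_
    rw [mem_Icc] at hj
    rw [← mul_sum]
    refine mul_nonpos_of_nonneg_of_nonpos (G.kc_pos (by omega) (by omega)).le ?_
    exact sum_mul_laplacian_ghost_nonpos G.one_le_Nx (fun i => a i j) G.hc (hx j).1 (hx j).2
      fun i hi => by rw [mem_Icc] at hi; exact (G.hc_pos (by omega) (by omega)).le
  have hz : ∑ i ∈ Icc (0 : ℤ) (G.Nx - 1), ∑ j ∈ Icc (1 : ℤ) (G.Ny - 1),
      G.hh i * (a i j * (z i j - z i (j - 1))) = -G.ipM (G.dyEy a) z := by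
    unfold ipM
    rw [← sum_neg_distrib]
    refine sum_congr rfl fun i hi => ?_
    rw [← mul_sum, sum_mul_sub_pred G.one_le_Ny (fun j => a i j) (fun j => z i j) (hy i).1
      (hy i).2, mul_neg, mul_sum]
    refine congrArg _ (sum_congr rfl fun j hj => ?_)
    rw [mem_Icc] at hj
    have := (G.kk_pos (j := j) (by omega) (by omega)).ne'
    unfold dyEy
    field_simp
  have hsum : G.ipMT a a = G.ipMT (fun i j => a0 i j + Δt * b i j) a +
      Δt * μ * (∑ i ∈ Icc (0 : ℤ) (G.Nx - 1), ∑ j ∈ Icc (1 : ℤ) (G.Ny - 1),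
        G.kc j * (a i j * (G.DxEy a (i + 1) j - G.DxEy a i j))) +
      Δt * μ * (∑ i ∈ Icc (0 : ℤ) (G.Nx - 1), ∑ j ∈ Icc (1 : ℤ) (G.Ny - 1),
        G.hh i * (a i j * (G.dyEy a i j - G.dyEy a i (j - 1)))) -
      Δt * (∑ i ∈ Icc (0 : ℤ) (G.Nx - 1), ∑ j ∈ Icc (1 : ℤ) (G.Ny - 1),
        G.hh i * (a i j * (z i j - z i (j - 1)))) := by
    unfold ipMT
    simp only [mul_sum, ← sum_add_distrib, ← sum_sub_distrib]
    refine sum_congr rfl fun i hi => sum_congr rfl fun j hj => ?_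
    rw [← heq i hi j hj]
    rw [mem_Icc] at hi hj
    have h1 := (G.hh_pos (i := i) (by omega) (by omega)).ne'
    have h2 := (G.kc_pos (j := j) (by omega) (by omega)).ne'
    unfold DyC
    field_simp
    ring
  have hm := mul_pos hΔ hμ
  rw [hsum, hz]
  nlinarith [mul_nonneg hm.le (neg_nonneg.2 hdx), mul_nonneg hm.le (neg_nonneg.2 hdy)]

lemma xEdge_weight_nonneg : ∀ i ∈ Icc (1 : ℤ) (G.Nx - 1), ∀ j ∈ Icc (0 : ℤ) (G.Ny - 1),
    0 ≤ G.hc i * G.kk j := by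
  intro i hi j hj
  rw [mem_Icc] at hi hj
  exact (mul_pos (G.hc_pos (by omega) (by omega)) (G.kk_pos (by omega) (by omega))).le

lemma yEdge_weight_nonneg : ∀ i ∈ Icc (0 : ℤ) (G.Nx - 1), ∀ j ∈ Icc (1 : ℤ) (G.Ny - 1),
    0 ≤ G.hh i * G.kc j := by
  intro i hi j hj
  rw [mem_Icc] at hi hj
  exact (mul_pos (G.hh_pos (by omega) (by omega)) (G.kc_pos (by omega) (by omega))).le

/-- Discrete divergence-free fields are orthogonal to the discrete pressure gradient. -/
lemma ipM_div_eq_zero {ax ay z : ℤ → ℤ → ℝ}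
    (hdiv : ∀ i ∈ Icc (0 : ℤ) (G.Nx - 1), ∀ j ∈ Icc (0 : ℤ) (G.Ny - 1),
      G.dxEx ax i j + G.dyEy ay i j = 0) :
    G.ipM (G.dxEx ax) z + G.ipM (G.dyEy ay) z = 0 := by
  unfold ipM
  simp only [← sum_add_distrib]
  refine sum_eq_zero fun i hi => sum_eq_zero fun j hj => ?_
  linear_combination G.hh i * G.kk j * z i j * hdiv i hi j hj

lemma velNormSq_add_le (ax ay cx cy : ℤ → ℤ → ℝ) (r c : ℝ) :
    r * G.velNormSq (fun i j => ax i j + c * cx i j) (fun i j => ay i j + c * cy i j) ≤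
      (1 + r) * G.velNormSq ax ay + r * (1 + r) * c ^ 2 * G.velNormSq cx cy := by
  have h1 := weighted_sum_sq_add_le (f := ax) (g := cx) G.xEdge_weight_nonneg r c
  have h2 := weighted_sum_sq_add_le (f := ay) (g := cy) G.yEdge_weight_nonneg r c
  unfold velNormSq ipTM ipMT
  linarith

/-- One time step does not increase the norm of the explicit update `W^{n-1} + Δt β̂^n`. -/
lemma IsRMAC.velNormSq_step {μ T Δt : ℝ} {G : Grid} {ux uy p gx gy : ℝ → ℝ → ℝ → ℝ}
    {Wx Wy Z : ℕ → ℤ → ℤ → ℝ} (hμ : 0 < μ) (hΔ : 0 < Δt)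
    (hux : Smooth ux) (huy : Smooth uy) (hp : Smooth p)
    (hS : IsStokesSol μ G.Lx G.Ly T ux uy p gx gy)
    (hW : G.IsRMAC μ Δt (G.avgFx gx Δt) (G.avgFy gy Δt) Wx Wy Z) {n : ℕ}
    (hn : ((n + 1 : ℕ) : ℝ) * Δt ≤ T) :
    G.velNormSq (Wx (n + 1)) (Wy (n + 1)) ≤ G.velNormSq
      (fun i j => Wx n i j +
        Δt * G.avgFx (fun x y t => gx x y t - pdx p x y t) Δt (n + 1) i j)
      (fun i j => Wy n i j +
        Δt * G.avgFy (fun x y t => gy x y t - pdy p x y t) Δt (n + 1) i j) := by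
  obtain ⟨hx0, hx1, hy0, hy1, -, hmx, hmy, hdiv⟩ := hW
  have ht : ((n + 1 : ℕ) : ℝ) * Δt ∈ Set.Ioc 0 T := ⟨by positivity, hn⟩
  set z : ℤ → ℤ → ℝ := fun a b => Z (n + 1) a b - p (G.xh a) (G.yh b) ((n + 1 : ℕ) * Δt) with hz
  have ex := G.momentum_x_energy (a := Wx (n + 1)) (a0 := Wx n) (z := z)
    (b := G.avgFx (fun x y t => gx x y t - pdx p x y t) Δt (n + 1)) hμ hΔ
    (hx0 _) (hx1 _) fun i hi j hj => by
      have h1 := hmx (n + 1) (by omega) i hi j hj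
      have h2 := G.avgFx_sub_pdx hux hp hS ht hi hj
      rw [Nat.add_sub_cancel] at h1
      rw [h2] at h1
      simp only [hz, DxC] at h1 ⊢
      linear_combination h1
  have ey := G.momentum_y_energy (a := Wy (n + 1)) (a0 := Wy n) (z := z)
    (b := G.avgFy (fun x y t => gy x y t - pdy p x y t) Δt (n + 1)) hμ hΔ
    (hy0 _) (hy1 _) fun i hi j hj => by
      have h1 := hmy (n + 1) (by omega) i hi j hj
      have h2 := G.avgFy_sub_pdy huy hp hS ht hi hj
      rw [Nat.add_sub_cancel] at h1
      rw [h2] at h1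
      simp only [hz, DyC] at h1 ⊢
      linear_combination h1
  have hd := G.ipM_div_eq_zero (z := z) (hdiv (n + 1) (by omega))
  have hd' : Δt * G.ipM (G.dxEx (Wx (n + 1))) z + Δt * G.ipM (G.dyEy (Wy (n + 1))) z = 0 := by
    rw [← mul_add, hd, mul_zero]
  have cx := two_mul_weighted_sum_le (g := Wx (n + 1)) (f := fun i j => Wx n i j +
    Δt * G.avgFx (fun x y t => gx x y t - pdx p x y t) Δt (n + 1) i j) G.xEdge_weight_nonneg
  have cy := two_mul_weighted_sum_le (g := Wy (n + 1)) (f := fun i j => Wy n i j +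
    Δt * G.avgFy (fun x y t => gy x y t - pdy p x y t) Δt (n + 1) i j) G.yEdge_weight_nonneg
  unfold velNormSq
  unfold ipTM at ex ⊢
  unfold ipMT at ey ⊢
  linarith

end Grid

end RMAC

/-- pressure-robust velocity stability of the RMAC scheme.
With `β = g − ∇p = ∂_t u − μΔu` and `β̂` its cell averages, for `Δt` sufficiently small there
is a constant `C` independent of `μ`, `h`, `k`, `Δt` such that
`‖W^m‖²_{l²} ≤ C Σ_{n=1}^m Δt ‖β̂^n‖²_{l²}` for all `1 ≤ m ≤ N`. -/
theorem rmac_velocity_stability (Lx Ly T : ℝ) (hLx : 0 < Lx) (hLy : 0 < Ly) (hT : 0 < T) :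
    ∃ C : ℝ, 0 < C ∧ ∃ δ : ℝ, 0 < δ ∧
      ∀ μ : ℝ, 0 < μ →
      ∀ G : RMAC.Grid, G.Lx = Lx → G.Ly = Ly →
      ∀ N : ℕ, 1 ≤ N → ∀ Δt : ℝ, Δt = T / N → Δt ≤ δ →
      ∀ ux uy p gx gy : ℝ → ℝ → ℝ → ℝ,
        RMAC.Smooth ux → RMAC.Smooth uy → RMAC.Smooth p →
        RMAC.IsStokesSol μ Lx Ly T ux uy p gx gy →
      ∀ Wx Wy Z : ℕ → ℤ → ℤ → ℝ,
        G.IsRMAC μ Δt (G.avgFx gx Δt) (G.avgFy gy Δt) Wx Wy Z →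
      ∀ bhx bhy : ℕ → ℤ → ℤ → ℝ,
        bhx = G.avgFx (fun x y t => gx x y t - RMAC.pdx p x y t) Δt →
        bhy = G.avgFy (fun x y t => gy x y t - RMAC.pdy p x y t) Δt →
      ∀ m : ℕ, 1 ≤ m → m ≤ N →
        G.velNormSq (Wx m) (Wy m) ≤
          C * ∑ n ∈ Finset.Icc 1 m, Δt * (G.ipTM (bhx n) (bhx n) + G.ipMT (bhy n) (bhy n)) := by
  refine ⟨T, hT, T, hT, ?_⟩
  intro μ hμ G hGx hGy N hN Δt hΔt _ ux uy p gx gy hux huy hp hS Wx Wy Z hW bhx bhy hbx hby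
  subst hGx hGy
  have hN' : (0 : ℝ) < N := by exact_mod_cast hN
  have hΔ : 0 < Δt := hΔt ▸ div_pos hT hN'
  have hNT : (N : ℝ) * Δt = T := by rw [hΔt]; field_simp
  have htime : ∀ n : ℕ, n ≤ N → (n : ℝ) * Δt ≤ T := fun n hn => by
    rw [← hNT]; gcongr
  have hB : ∀ n, 0 ≤ G.velNormSq (bhx n) (bhy n) := fun n => by
    have := G.velNormSq_add_le (bhx n) (bhy n) (bhx n) (bhy n) 1 (-1)
    simp [Grid.velNormSq, Grid.ipTM, Grid.ipMT] at this ⊢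
    linarith
  have hW0 : Wx 0 = 0 ∧ Wy 0 = 0 :=
    ⟨funext₂ fun i j => (hW.2.2.2.2.1 i j).1, funext₂ fun i j => (hW.2.2.2.2.1 i j).2⟩
  have key : ∀ m : ℕ, m ≤ N → G.velNormSq (Wx m) (Wy m) ≤
      m * Δt * ∑ n ∈ Finset.Icc 1 m, Δt * G.velNormSq (bhx n) (bhy n) := by
    intro m
    induction m with
    | zero => intro _; simp [hW0.1, hW0.2, Grid.velNormSq, Grid.ipTM, Grid.ipMT]
    | succ m ih =>
      intro hm
      have hstep := hW.velNormSq_step hμ hΔ hux huy hp hS (htime (m + 1) hm)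
      rw [← hbx, ← hby] at hstep
      rw [Finset.sum_Icc_succ_top (by omega)]
      rcases Nat.eq_zero_or_pos m with rfl | hpos
      · refine hstep.trans (le_of_eq ?_)
        simp only [hW0.1, hW0.2, Grid.velNormSq, Grid.ipTM, Grid.ipMT]
        simp [Finset.mul_sum, mul_add]
        congr 1 <;> refine Finset.sum_congr rfl fun i _ => Finset.sum_congr rfl fun j _ => ?_ <;>
          ring
      · have hm' : (0 : ℝ) < m := by exact_mod_cast hpos
        have hadd := G.velNormSq_add_le (Wx m) (Wy m) (bhx (m + 1)) (bhy (m + 1)) m Δt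
        have hprev := mul_le_mul_of_nonneg_left (ih (by omega)) (by positivity : (0 : ℝ) ≤ 1 + m)
        have hmul := mul_le_mul_of_nonneg_left hstep hm'.le
        refine le_of_mul_le_mul_left ?_ hm'
        push_cast
        linarith
  intro m _ hm
  refine (key m hm).trans ?_
  exact mul_le_mul_of_nonneg_right (htime m hm)
    (Finset.sum_nonneg fun n _ => mul_nonneg hΔ.le (hB n))
end
end
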